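/- A commutative noetherian ring A is Gorenstein if and only if every acyclic cochain complex of flat A-modules is N-totally acyclic, i.e., if and only if for every acyclic complex F of flat A-modules and every injective A-module I the complex F ⊗_A I is acyclic. -/

import Mathlib

universe u

/-- A cochain complex `(X, d)` of flat `A`-modules is *N-totally acyclic* if it is acyclic
and `X ⊗_A I` is acyclic for every injective `A`-module `I`. -/
def IsNTotallyAcyclic (A : Type u) [CommRing A] (X : ℤ → Type u)
    [∀ n, AddCommGroup (X n)] [∀ n, Module A (X n)]
    (d : ∀ n, X n →ₗ[A] X (n + 1)) : Prop :=
  (∀ n, Function.Exact (d n) (d (n + 1))) ∧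
  ∀ (I : Type u) [AddCommGroup I] [Module A I], Module.Injective A I →
    ∀ n, Function.Exact (LinearMap.rTensor I (d n)) (LinearMap.rTensor I (d (n + 1)))

/-- An `R`-module `M` has finite injective dimension: there is a finite injective
coresolution `0 → M → I⁰ → I¹ → ⋯ → Iⁿ → 0`. -/
def HasFiniteInjectiveDimension (R : Type u) [CommRing R] (M : Type u) [AddCommGroup M]
    [Module R M] : Prop :=
  ∃ (n : ℕ) (I : ℕ → Type u) (_ : ∀ j, AddCommGroup (I j)) (_ : ∀ j, Module R (I j))
    (ι : M →ₗ[R] I 0) (d : ∀ j, I j →ₗ[R] I (j + 1)),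
    (∀ j, Module.Injective R (I j)) ∧ Function.Injective ι ∧ Function.Exact ι (d 0) ∧
    (∀ j, Function.Exact (d j) (d (j + 1))) ∧ ∀ j, n < j → Subsingleton (I j)

/-- A commutative noetherian ring is Gorenstein if each localization at a prime has finite
injective dimension over itself. -/
def IsGorensteinRing (A : Type u) [CommRing A] : Prop :=
  ∀ (p : Ideal A) (_ : p.IsPrime),
    HasFiniteInjectiveDimension (Localization.AtPrime p) (Localization.AtPrime p)

open TensorProduct

theorem gor_flat_hom {R : Type u} [CommRing R] [IsNoetherianRing R] (J I : Type u)
    [AddCommGroup J] [Module R J] [AddCommGroup I] [Module R I]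
    [Module.Injective R J] [Module.Injective R I] : Module.Flat R (J →ₗ[R] I) := by
  apply Module.Flat.of_forall_isTrivialRelation
  intro l f x h
  -- the syzygies of f
  let F : (Fin l → R) →ₗ[R] R := Fintype.linearCombination R f
  obtain ⟨q, c, hc⟩ := Submodule.fg_iff_exists_fin_generating_family.mp
    (IsNoetherian.noetherian (LinearMap.ker F))
  have hcm : ∀ k, c k ∈ LinearMap.ker F := fun k => hc ▸ Submodule.subset_span ⟨k, rfl⟩
  let C : (Fin l → J) →ₗ[R] (Fin q → J) :=
    LinearMap.pi fun k => ∑ i, (c k i) • LinearMap.proj i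
  let Φ : (Fin l → J) →ₗ[R] I := ∑ i, x i ∘ₗ LinearMap.proj i
  have key : LinearMap.ker C ≤ LinearMap.ker Φ := by
    intro y hy
    -- map R^l → J by e_i ↦ y_i kills ker F
    let g : (Fin l → R) →ₗ[R] J := Fintype.linearCombination R y
    have hg : LinearMap.ker F ≤ LinearMap.ker g := by
      rw [← hc, Submodule.span_le]
      rintro _ ⟨k, rfl⟩
      have := congrFun (LinearMap.mem_ker.mp hy) k
      simpa [C, g, Fintype.linearCombination_apply] using this
    obtain ⟨t, ht⟩ := Module.Injective.extension_property R J _ _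
      ((LinearMap.ker F).liftQ F le_rfl) (by
        rw [← LinearMap.ker_eq_bot]; exact Submodule.ker_liftQ_eq_bot _ _ _ le_rfl)
      ((LinearMap.ker F).liftQ g hg)
    have hy' : ∀ i, y i = f i • t 1 := by
      intro i
      have := LinearMap.congr_fun ht (Submodule.Quotient.mk (Pi.single i 1))
      simp only [LinearMap.comp_apply, Submodule.liftQ_apply] at this
      have e1 : F (Pi.single i 1) = f i • 1 := by simp [F]
      have e2 : g (Pi.single i 1) = y i := by simp [g]
      rw [e1, e2, map_smul] at this
      exact this.symm
    have h2 := LinearMap.congr_fun h (t 1)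
    simp only [LinearMap.sum_apply, LinearMap.smul_apply, LinearMap.zero_apply] at h2
    simp [Φ, LinearMap.sum_apply, hy', h2]
  obtain ⟨ψ, hψ⟩ := Module.Injective.extension_property R I _ _
      ((LinearMap.ker C).liftQ C le_rfl) (by
        rw [← LinearMap.ker_eq_bot]; exact Submodule.ker_liftQ_eq_bot _ _ _ le_rfl)
      ((LinearMap.ker C).liftQ Φ key)
  refine ⟨q, fun i k => c k i, fun k => ψ ∘ₗ LinearMap.single R (fun _ => J) k, ?_, ?_⟩
  · intro i
    ext j
    have := LinearMap.congr_fun hψ (Submodule.Quotient.mk (Pi.single i j))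
    simp only [LinearMap.comp_apply, Submodule.liftQ_apply] at this
    have e1 : Φ (Pi.single i j) = x i j := by
      simp [Φ, LinearMap.sum_apply, Pi.single_apply, apply_ite]
    have e2 : C (Pi.single i j) = ∑ k, Pi.single k (c k i • j) := by
      ext k
      simp [C, LinearMap.sum_apply, Pi.single_apply, Finset.sum_apply]
    rw [e1, e2, map_sum] at this
    rw [← this]
    simp only [LinearMap.sum_apply, LinearMap.smul_apply, LinearMap.comp_apply, LinearMap.coe_single]
    refine Finset.sum_congr rfl fun k _ => ?_
    rw [Pi.single_smul, map_smul]
  · intro k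
    have := hcm k
    simp only [F, LinearMap.mem_ker, Fintype.linearCombination_apply, smul_eq_mul] at this
    rw [← this]
    exact Finset.sum_congr rfl fun i _ => mul_comm _ _

section fwd
variable {A : Type u} [CommRing A] {X : ℤ → Type u}
    [∀ n, AddCommGroup (X n)] [∀ n, Module A (X n)]
    (d : ∀ n, X n →ₗ[A] X (n + 1))

def GorTens (N : Type u) [AddCommGroup N] [Module A N] : Prop :=
  ∀ n, Function.Exact (LinearMap.rTensor N (d n)) (LinearMap.rTensor N (d (n + 1)))

theorem gor_two_of_three [∀ n, Module.Flat A (X n)] (hd : ∀ n, Function.Exact (d n) (d (n + 1)))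
    {K L N : Type u} [AddCommGroup K] [Module A K] [AddCommGroup L] [Module A L]
    [AddCommGroup N] [Module A N] (i : K →ₗ[A] L) (p : L →ₗ[A] N)
    (hi : Function.Injective i) (hip : Function.Exact i p) (hp : Function.Surjective p)
    (hK : GorTens d K) (hL : GorTens d L) : GorTens d N := by
  have comm : ∀ {M M' : Type u} [AddCommGroup M] [Module A M] [AddCommGroup M'] [Module A M']
      (f : M →ₗ[A] M') (n : ℤ) (y : X n ⊗[A] M),
      LinearMap.rTensor M' (d n) (LinearMap.lTensor (X n) f y) =
      LinearMap.lTensor (X (n+1)) f (LinearMap.rTensor M (d n) y) := by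
    intro M M' _ _ _ _ f n y
    rw [← LinearMap.comp_apply, ← LinearMap.comp_apply, LinearMap.rTensor_comp_lTensor,
      LinearMap.lTensor_comp_rTensor]
  have dd : ∀ (M : Type u) [AddCommGroup M] [Module A M] (n : ℤ) (y : X n ⊗[A] M),
      LinearMap.rTensor M (d (n+1)) (LinearMap.rTensor M (d n) y) = 0 := by
    intro M _ _ n y
    rw [← LinearMap.comp_apply, ← LinearMap.rTensor_comp, (hd n).linearMap_comp_eq_zero]
    simp
  intro n z
  constructor
  · intro hz
    obtain ⟨y, rfl⟩ := LinearMap.lTensor_surjective (X (n+1)) hp z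
    rw [comm] at hz
    obtain ⟨k, hk⟩ := (lTensor_exact (X (n+1+1)) hip hp _).mp hz
    have h0 : LinearMap.rTensor K (d (n+1+1)) k = 0 := by
      apply Module.Flat.lTensor_preserves_injective_linearMap (M := X (n+1+1+1)) i hi
      rw [← comm, hk, dd, map_zero]
    obtain ⟨k', rfl⟩ := (hK _ _).mp h0
    have h1 : LinearMap.rTensor L (d (n+1)) (y - LinearMap.lTensor _ i k') = 0 := by
      rw [map_sub, comm, hk, sub_self]
    obtain ⟨y', hy'⟩ := (hL _ _).mp h1
    refine ⟨LinearMap.lTensor _ p y', ?_⟩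
    rw [comm, hy', map_sub]
    have : LinearMap.lTensor (X (n+1)) p (LinearMap.lTensor (X (n+1)) i k') = 0 :=
      (lTensor_exact (X (n+1)) hip hp _).mpr ⟨_, rfl⟩
    rw [this, sub_zero]
  · rintro ⟨y, rfl⟩
    exact dd _ _ _

theorem gor_tens_flat (hd : ∀ n, Function.Exact (d n) (d (n + 1)))
    (N : Type u) [AddCommGroup N] [Module A N] [Module.Flat A N] : GorTens d N :=
  fun n => Module.Flat.rTensor_exact N (hd n)

theorem gor_tens_inj [∀ n, Module.Flat A (X n)] (hd : ∀ n, Function.Exact (d n) (d (n + 1)))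
    {R : Type u} [CommRing R] [IsNoetherianRing R] [Algebra A R] [Module.Flat A R]
    {M : Type u} [AddCommGroup M] [Module A M] [Module R M] [IsScalarTower A R M]
    [Module.Injective R M]
    (n : ℕ) (I : ℕ → Type u) [∀ j, AddCommGroup (I j)] [∀ j, Module R (I j)]
    (ι : R →ₗ[R] I 0) (δ : ∀ j, I j →ₗ[R] I (j + 1))
    (hI : ∀ j, Module.Injective R (I j)) (hι : Function.Injective ι)
    (h0 : Function.Exact ι (δ 0)) (hδ : ∀ j, Function.Exact (δ j) (δ (j + 1)))
    (hn : ∀ j, n < j → Subsingleton (I j)) : GorTens d M := by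
  have flat : ∀ j, Module.Flat A (I j →ₗ[R] M) := by
    intro j
    have := gor_flat_hom (R := R) (I j) M
    exact Module.Flat.trans A R _
  have main : ∀ k j, n < j + k → GorTens d (LinearMap.ker (δ j) →ₗ[R] M) := by
    intro k
    induction k with
    | zero =>
      intro j hj
      have := hn j hj
      have : Subsingleton (LinearMap.ker (δ j) →ₗ[R] M) := ⟨fun a b => by
        ext x
        rw [Subsingleton.elim x 0, map_zero, map_zero]⟩
      exact gor_tens_flat d hd _
    | succ k ih =>
      intro j hj
      have hK := ih (j+1) (by omega)
      let δ' : I j →ₗ[R] LinearMap.ker (δ (j+1)) :=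
        (δ j).codRestrict _ fun x => (hδ j).apply_apply_eq_zero x
      have hs : Function.Surjective δ' := by
        rintro ⟨y, hy⟩
        obtain ⟨x, hx⟩ := (hδ j y).mp hy
        exact ⟨x, Subtype.ext hx⟩
      refine gor_two_of_three d hd
        ((LinearMap.lcomp R M δ').restrictScalars A)
        ((LinearMap.lcomp R M (LinearMap.ker (δ j)).subtype).restrictScalars A)
        ?_ ?_ ?_ hK (gor_tens_flat d hd _)
      · intro a b hab
        ext x
        obtain ⟨y, rfl⟩ := hs x
        exact LinearMap.congr_fun hab y
      · intro φ
        constructor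
        · intro hφ
          have hk : LinearMap.ker δ' ≤ LinearMap.ker φ := by
            intro x hx
            have : δ j x = 0 := congrArg Subtype.val hx
            exact LinearMap.congr_fun hφ ⟨x, this⟩
          refine ⟨(LinearMap.ker δ').liftQ φ hk ∘ₗ
            (LinearMap.quotKerEquivOfSurjective δ' hs).symm.toLinearMap, ?_⟩
          ext x
          change (LinearMap.ker δ').liftQ φ hk
            ((LinearMap.quotKerEquivOfSurjective δ' hs).symm (δ' x)) = φ x
          have : (LinearMap.quotKerEquivOfSurjective δ' hs).symm (δ' x) =
            Submodule.Quotient.mk x := by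
            rw [LinearEquiv.symm_apply_eq]; rfl
          rw [this]; simp
        · rintro ⟨ψ, rfl⟩
          ext ⟨x, hx⟩
          change ψ (δ' x) = 0
          have : δ' x = 0 := Subtype.ext hx
          rw [this, map_zero]
      · intro φ
        obtain ⟨t, ht⟩ := Module.Injective.extension_property R M _ _
          (LinearMap.ker (δ j)).subtype Subtype.val_injective φ
        exact ⟨t, ht⟩
  have h1 := main (n+1) 0 (by omega)
  let ι' : R →ₗ[R] LinearMap.ker (δ 0) := ι.codRestrict _ fun x => h0.apply_apply_eq_zero x
  have hb : Function.Bijective ι' := by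
    refine ⟨fun a b hab => hι (congrArg Subtype.val hab), ?_⟩
    rintro ⟨y, hy⟩
    obtain ⟨x, hx⟩ := (h0 y).mp hy
    exact ⟨x, Subtype.ext hx⟩
  let p : (LinearMap.ker (δ 0) →ₗ[R] M) →ₗ[A] M :=
    (LinearMap.applyₗ (R := R) (ι' 1)).restrictScalars A
  have hp0 : ∀ φ, p φ = φ (ι' 1) := fun φ => rfl
  refine gor_two_of_three d hd (0 : PUnit.{u+1} →ₗ[A] _) p
    (Function.injective_of_subsingleton _) ?_ ?_ (gor_tens_flat d hd _) h1
  · intro φ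
    constructor
    · intro h
      refine ⟨0, ?_⟩
      rw [map_zero]
      ext x
      obtain ⟨r, rfl⟩ := hb.2 x
      rw [hp0] at h
      have : ι' r = r • ι' 1 := by rw [← map_smul, smul_eq_mul, mul_one]
      rw [this, map_smul, map_smul, h]; simp
    · rintro ⟨_, rfl⟩; simp
  · intro m
    refine ⟨LinearMap.toSpanSingleton R M m ∘ₗ (LinearEquiv.ofBijective ι' hb).symm.toLinearMap, ?_⟩
    rw [hp0]
    have : (LinearEquiv.ofBijective ι' hb).symm (ι' 1) = 1 := by
      rw [LinearEquiv.symm_apply_eq]; rfl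
    simp [this]

theorem gor_forward [IsNoetherianRing A]
    (hG : ∀ (p : Ideal A) (_ : p.IsPrime), ∃ (n : ℕ) (I : ℕ → Type u)
      (_ : ∀ j, AddCommGroup (I j)) (_ : ∀ j, Module (Localization.AtPrime p) (I j))
    (ι : Localization.AtPrime p →ₗ[Localization.AtPrime p] I 0)
    (d : ∀ j, I j →ₗ[Localization.AtPrime p] I (j + 1)),
    (∀ j, Module.Injective (Localization.AtPrime p) (I j)) ∧ Function.Injective ι ∧
    Function.Exact ι (d 0) ∧
    (∀ j, Function.Exact (d j) (d (j + 1))) ∧ ∀ j, n < j → Subsingleton (I j))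
    [∀ n, Module.Flat A (X n)] (hd : ∀ n, Function.Exact (d n) (d (n + 1)))
    (I : Type u) [AddCommGroup I] [Module A I] [Module.Injective A I] : GorTens d I := by
  intro n
  let Mp : ∀ (J : Ideal A) [J.IsMaximal], Type u := fun J _ => LocalizedModule J.primeCompl I
  let f : ∀ (m : ℤ) (J : Ideal A) [J.IsMaximal], X m ⊗[A] I →ₗ[A] X m ⊗[A] (LocalizedModule J.primeCompl I) :=
    fun m J _ => LinearMap.lTensor (X m) (LocalizedModule.mkLinearMap J.primeCompl I)
  have inst : ∀ (m : ℤ) (J : Ideal A) [J.IsMaximal], IsLocalizedModule.AtPrime J (f m J) := by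
    intro m J _
    have h1 : IsLocalizedModule J.primeCompl (AlgebraTensorModule.rTensor A (X m)
      (LocalizedModule.mkLinearMap J.primeCompl I)) := inferInstance
    have h2 := IsLocalizedModule.of_linearEquiv J.primeCompl (AlgebraTensorModule.rTensor A (X m)
      (LocalizedModule.mkLinearMap J.primeCompl I)) (TensorProduct.comm A _ (X m))
    have h3 := IsLocalizedModule.of_linearEquiv_right J.primeCompl
      ((TensorProduct.comm A _ (X m)).toLinearMap ∘ₗ (AlgebraTensorModule.rTensor A (X m)
      (LocalizedModule.mkLinearMap J.primeCompl I))) (TensorProduct.comm A (X m) I)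
    have h4 : f m J = ((TensorProduct.comm A _ (X m)).toLinearMap ∘ₗ
      (AlgebraTensorModule.rTensor A (X m)
      (LocalizedModule.mkLinearMap J.primeCompl I))) ∘ₗ (TensorProduct.comm A (X m) I).toLinearMap := by
      ext x y
      simp [f]
    rw [h4]
    exact h3
  have i0 := inst n
  have i1 := inst (n+1)
  have i2 := inst (n+1+1)
  refine @exact_of_isLocalized_maximal A _ _ _ _ _ _ _ _ _ _
    (fun J _ => X n ⊗[A] (LocalizedModule J.primeCompl I)) _ _ (f n) i0
    (fun J _ => X (n+1) ⊗[A] (LocalizedModule J.primeCompl I)) _ _ (f (n+1)) i1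
    (fun J _ => X (n+1+1) ⊗[A] (LocalizedModule J.primeCompl I)) _ _ (f (n+1+1)) i2 _ _ ?_
  intro J hJ
  obtain ⟨k, Ij, _, _, ι, δ, h1, h2, h3, h4, h5⟩ := hG J hJ.isPrime
  have : Module.Injective (Localization.AtPrime J) (LocalizedModule J.primeCompl I) :=
    Module.injective_of_isLocalizedModule J.primeCompl (LocalizedModule.mkLinearMap J.primeCompl I)
  have : IsNoetherianRing (Localization.AtPrime J) :=
    IsLocalization.isNoetherianRing J.primeCompl _ inferInstance
  have : Module.Flat A (Localization.AtPrime J) := IsLocalization.flat _ J.primeCompl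
  have := gor_tens_inj d hd (R := Localization.AtPrime J) (M := LocalizedModule J.primeCompl I)
    k Ij ι δ h1 h2 h3 h4 h5 n
  have e : ∀ m, IsLocalizedModule.map J.primeCompl (f m J) (f (m+1) J) (LinearMap.rTensor I (d m)) =
      LinearMap.rTensor (LocalizedModule J.primeCompl I) (d m) := by
    intro m
    apply IsLocalizedModule.linearMap_ext J.primeCompl (f m J) (f (m+1) J)
    rw [IsLocalizedModule.map_comp]
    simp only [f]
    rw [LinearMap.rTensor_comp_lTensor, LinearMap.lTensor_comp_rTensor]
  rw [e, e]
  exact this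
end fwd

section gorext
open CategoryTheory Abelian

theorem gor_ses {R : Type u} [CommRing R] {M N P : Type u} [AddCommGroup M] [AddCommGroup N]
    [AddCommGroup P] [Module R M] [Module R N] [Module R P] (f : M →ₗ[R] N) (g : N →ₗ[R] P)
    (hf : Function.Injective f) (hg : Function.Surjective g) (h : Function.Exact f g) :
    (ShortComplex.mk (ModuleCat.ofHom f) (ModuleCat.ofHom g)
      (by ext x; exact h.apply_apply_eq_zero x)).ShortExact := by
  have : Mono (ModuleCat.ofHom f) := (ModuleCat.mono_iff_injective _).2 hf
  have : Epi (ModuleCat.ofHom g) := (ModuleCat.epi_iff_surjective _).2 hg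
  refine ⟨?_⟩
  rw [ShortComplex.ShortExact.moduleCat_exact_iff_function_exact]
  exact h

def GorExtV {R : Type u} [CommRing R] (Y : Type u) [AddCommGroup Y] [Module R Y] (N : ℕ)
    (M : Type u) [AddCommGroup M] [Module R M] : Prop :=
  ∀ i, N ≤ i → ∀ e : Ext (ModuleCat.of R M) (ModuleCat.of R Y) i, e = 0

section
variable {R : Type u} [CommRing R] {Y : Type u} [AddCommGroup Y] [Module R Y] {N : ℕ}
    {M₁ M₂ M₃ : Type u} [AddCommGroup M₁] [AddCommGroup M₂]
    [AddCommGroup M₃] [Module R M₁] [Module R M₂] [Module R M₃]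

theorem gor_extv_mid (f : M₁ →ₗ[R] M₂) (g : M₂ →ₗ[R] M₃)
    (hf : Function.Injective f) (hg : Function.Surjective g) (h : Function.Exact f g)
    (h1 : GorExtV (R := R) Y N M₁) (h3 : GorExtV (R := R) Y N M₃) : GorExtV (R := R) Y N M₂ := by
  intro i hi e
  obtain ⟨y, hy⟩ := Ext.contravariant_sequence_exact₂ (gor_ses f g hf hg h) (ModuleCat.of R Y) e
    (h1 i hi _)
  rw [← hy, h3 i hi y]
  simp

theorem gor_extv_equiv (f : M₁ ≃ₗ[R] M₂) (h1 : GorExtV (R := R) Y N M₁) :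
    GorExtV (R := R) Y N M₂ := by
  intro i hi e
  have : e = (Ext.mk₀ (ModuleCat.ofHom f.symm.toLinearMap)).comp
    ((Ext.mk₀ (ModuleCat.ofHom f.toLinearMap)).comp e (zero_add i)) (zero_add i) := by
    rw [Ext.mk₀_comp_mk₀_assoc]
    have : ModuleCat.ofHom f.symm.toLinearMap ≫ ModuleCat.ofHom f.toLinearMap = 𝟙 _ := by
      ext x; simp
    rw [this]; simp
  rw [this, h1 i hi ((Ext.mk₀ (ModuleCat.ofHom f.toLinearMap)).comp e (zero_add i))]; simp

theorem gor_extv_subsingleton [Subsingleton M₁] : GorExtV (R := R) Y N M₁ := by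
  intro i hi e
  have : e = (Ext.mk₀ (𝟙 _)).comp e (zero_add i) := by simp
  have h0 : 𝟙 (ModuleCat.of R M₁) = 0 := by
    ext x
    exact Subsingleton.elim (α := M₁) _ _
  rw [this, h0]; simp

theorem gor_extv_kill [IsLocalRing R] [IsNoetherianRing R]
    (hk : GorExtV (R := R) Y N (R ⧸ IsLocalRing.maximalIdeal R))
    (hM : Module.Finite R M₁) : (∀ x ∈ IsLocalRing.maximalIdeal R, ∀ y : M₁, x • y = 0) →
      GorExtV (R := R) Y N M₁ := by
  induction hM using IsNoetherianRing.induction_on_isQuotientEquivQuotientPrime with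
  | subsingleton N => exact fun _ => gor_extv_subsingleton
  | quotient N p f =>
    intro h
    have : p.1 = IsLocalRing.maximalIdeal R := by
      apply le_antisymm (IsLocalRing.le_maximalIdeal p.2.ne_top)
      intro x hx
      have := h x hx (f.symm 1)
      rw [← map_smul, LinearEquiv.map_eq_zero_iff] at this
      rw [← Ideal.Quotient.eq_zero_iff_mem]
      rw [← this]
      simp [Algebra.smul_def]
    rw [this] at f
    exact gor_extv_equiv f.symm hk
  | exact N₁ N₂ N₃ f g hf hg hfg h₁ h₃ =>
    intro h
    refine gor_extv_mid f g hf hg hfg (h₁ fun x hx y => hf ?_) (h₃ fun x hx y => ?_)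
    · simp [h x hx]
    · obtain ⟨y, rfl⟩ := hg y
      simp [← map_smul, h x hx]

theorem gor_extv_all [IsLocalRing R] [IsNoetherianRing R] [Module.Finite R Y]
    (hk : GorExtV (R := R) Y N (R ⧸ IsLocalRing.maximalIdeal R)) (b : Ideal R) :
    ∀ (M : Type u) [AddCommGroup M] [Module R M] [Module.Finite R M],
      (∀ x ∈ b, ∀ y : M, x • y = 0) → GorExtV (R := R) Y N M := by
  induction b using IsNoetherian.induction with
  | hgt b ih =>
  intro M _ _ _ hb
  by_cases hm : IsLocalRing.maximalIdeal R ≤ b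
  · exact gor_extv_kill hk inferInstance fun x hx => hb x (hm hx)
  obtain ⟨x, hxm, hxb⟩ := Set.not_subset.1 hm
  have hlt : b < b ⊔ Ideal.span {x} := by
    rw [left_lt_sup]
    rw [Ideal.span_singleton_le_iff_mem]; exact hxb
  let f : M →ₗ[R] M := LinearMap.lsmul R M x
  have hkill : ∀ (L : Type u) [AddCommGroup L] [Module R L], (∀ y ∈ b, ∀ z : L, y • z = 0) →
    (∀ z : L, x • z = 0) → ∀ y ∈ b ⊔ Ideal.span {x}, ∀ z : L, y • z = 0 := by
    intro L _ _ h1 h2 y hy z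
    obtain ⟨u, hu, v, hv, rfl⟩ := Submodule.mem_sup.1 hy
    obtain ⟨w, rfl⟩ := Ideal.mem_span_singleton'.1 hv
    rw [add_smul, h1 u hu, mul_smul, h2]; simp
  have hK : GorExtV (R := R) Y N (LinearMap.ker f) := by
    refine ih _ hlt _ (hkill _ (fun y hy z => Subtype.ext (hb y hy z)) fun z => Subtype.ext z.2)
  have hQ : GorExtV (R := R) Y N (M ⧸ LinearMap.range f) := by
    refine ih _ hlt _ (hkill _ (fun y hy z => ?_) fun z => ?_)
    · obtain ⟨z, rfl⟩ := Submodule.mkQ_surjective _ z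
      rw [← map_smul, hb y hy, map_zero]
    · obtain ⟨z, rfl⟩ := Submodule.mkQ_surjective _ z
      rw [← map_smul, Submodule.mkQ_apply, Submodule.Quotient.mk_eq_zero]
      exact ⟨z, rfl⟩
  have S1 := gor_ses (LinearMap.ker f).subtype f.rangeRestrict (Submodule.subtype_injective _)
    f.surjective_rangeRestrict (by
      rw [LinearMap.exact_iff]; simp)
  have S2 := gor_ses (LinearMap.range f).subtype (LinearMap.range f).mkQ
    (Submodule.subtype_injective _) (Submodule.mkQ_surjective _)
    (LinearMap.exact_subtype_mkQ _)
  intro i hi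
  have hsurj : ∀ e : Ext (ModuleCat.of R M) (ModuleCat.of R Y) i, ∃ e', e = x • e' := by
    intro e
    obtain ⟨e1, h1⟩ := Ext.contravariant_sequence_exact₂ S1 _ e (hK i hi _)
    obtain ⟨e2, h2⟩ := Ext.contravariant_sequence_exact₁ S2 _ e1 (add_comm 1 i)
      (hQ (i+1) (by omega) _)
    refine ⟨e2, ?_⟩
    rw [← h1, ← h2]
    dsimp only
    rw [Ext.mk₀_comp_mk₀_assoc]
    have : ModuleCat.ofHom f.rangeRestrict ≫ ModuleCat.ofHom (LinearMap.range f).subtype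
      = x • 𝟙 (ModuleCat.of R M) := by
      ext y; rfl
    rw [this, Ext.mk₀_smul, Ext.smul_comp, Ext.mk₀_id_comp]
  have htop : (⊤ : Submodule R (Ext (ModuleCat.of R M) (ModuleCat.of R Y) i)) = ⊥ := by
    apply Submodule.eq_bot_of_le_smul_of_le_jacobson_bot (IsLocalRing.maximalIdeal R) _
      Module.Finite.fg_top
    · intro e _
      obtain ⟨e', rfl⟩ := hsurj e
      exact Submodule.smul_mem_smul hxm trivial
    · rw [IsLocalRing.jacobson_eq_maximalIdeal _ bot_ne_top]
  intro e
  have : e ∈ (⊤ : Submodule R (Ext (ModuleCat.of R M) (ModuleCat.of R Y) i)) := trivial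
  rw [htop] at this
  exact this

end

theorem gor_extv_res {R : Type u} [CommRing R] (a : ℕ → ℕ) (Ω : ℕ → Type u)
    [∀ n, AddCommGroup (Ω n)] [∀ n, Module R (Ω n)] (π : ∀ n, (Fin (a n) → R) →ₗ[R] Ω n)
    (j : ∀ n, Ω (n+1) →ₗ[R] (Fin (a n) → R)) (hπ : ∀ n, Function.Surjective (π n))
    (hj : ∀ n, Function.Injective (j n)) (hjπ : ∀ n, Function.Exact (j n) (π n)) (N : ℕ)
    (hN : ∀ n, N ≤ n → ∀ φ : (Fin (a (n+1)) → R) →ₗ[R] R, φ ∘ₗ (j (n+1) ∘ₗ π (n+2)) = 0 →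
      ∃ ψ : (Fin (a n) → R) →ₗ[R] R, φ = ψ ∘ₗ (j n ∘ₗ π (n+1))) :
    GorExtV (R := R) R (N+1) (Ω 0) := by
  have key : ∀ k n, N ≤ n + k → ∀ e : Ext (ModuleCat.of R (Ω n)) (ModuleCat.of R R) (k+1),
      e = 0 := by
    intro k
    induction k with
    | zero =>
      intro n hn e
      have S := gor_ses (j n) (π n) (hj n) (hπ n) (hjπ n)
      obtain ⟨x, hx⟩ := Ext.contravariant_sequence_exact₃ S _ e (Ext.eq_zero_of_projective _)
        (add_zero 1)
      obtain ⟨g, rfl⟩ := (Ext.homEquiv₀ (X := ModuleCat.of R (Ω (n+1)))).symm.surjective x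
      obtain ⟨ψ, hψ⟩ := hN n hn (g.hom ∘ₗ π (n+1)) (by
        ext1 y
        ext
        have := (hjπ (n+1)).apply_apply_eq_zero (π (n+2) (LinearMap.single R _ y 1))
        simp only [LinearMap.coe_comp, Function.comp_apply, LinearMap.zero_apply]
        rw [this, map_zero])
      have hg : g = ModuleCat.ofHom (j n) ≫ ModuleCat.ofHom ψ := by
        ext y
        obtain ⟨y, rfl⟩ := hπ (n+1) y
        exact congr($hψ y)
      rw [← hx, Ext.homEquiv₀_symm_apply, hg, ← Ext.mk₀_comp_mk₀]
      exact S.extClass_comp_assoc _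
    | succ k ih =>
      intro n hn e
      have S := gor_ses (j n) (π n) (hj n) (hπ n) (hjπ n)
      obtain ⟨x, hx⟩ := Ext.contravariant_sequence_exact₃ S _ e (Ext.eq_zero_of_projective _)
        (add_comm 1 (k+1))
      rw [← hx, ih (n+1) (by omega) x]
      simp
  intro i hi e
  obtain ⟨k, rfl⟩ : ∃ k, i = k + 1 := ⟨i - 1, by omega⟩
  exact key k 0 (by omega) e

theorem gor_exists_res {R : Type u} [CommRing R] [IsNoetherianRing R] (M : Type u)
    [AddCommGroup M] [Module R M] [Module.Finite R M] :
    ∃ (a : ℕ → ℕ) (Ω : ℕ → Type u) (_ : ∀ n, AddCommGroup (Ω n)) (_ : ∀ n, Module R (Ω n))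
      (π : ∀ n, (Fin (a n) → R) →ₗ[R] Ω n) (j : ∀ n, Ω (n+1) →ₗ[R] (Fin (a n) → R)),
      (∀ n, Function.Surjective (π n)) ∧ (∀ n, Function.Injective (j n)) ∧
      (∀ n, Function.Exact (j n) (π n)) ∧ Nonempty (Ω 0 ≃ₗ[R] M) := by
  let T := {M : ModuleCat.{u} R // Module.Finite R M}
  have h : ∀ M : T, ∃ (n : ℕ) (f : (Fin n → R) →ₗ[R] M.1), Function.Surjective f := fun M =>
    haveI := M.2
    Module.Finite.exists_fin' R M.1
  choose n f hf using h
  let step : T → T := fun M => ⟨ModuleCat.of R (LinearMap.ker (f M)),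
    inferInstanceAs (Module.Finite R (LinearMap.ker (f M)))⟩
  let W : ℕ → T := fun k => Nat.rec ⟨ModuleCat.of R M, ‹_›⟩ (fun _ => step) k
  refine ⟨fun k => n (W k), fun k => (W k).1, fun k => inferInstance, fun k => inferInstance,
    fun k => f (W k), fun k => (LinearMap.ker (f (W k))).subtype, fun k => hf _,
    fun k => Submodule.subtype_injective _, fun k => ?_, ⟨LinearEquiv.refl _ _⟩⟩
  exact LinearMap.exact_subtype_ker_map (f (W k))

theorem gor_fid_splice {R : Type u} [CommRing R] {M J Z : Type u} [AddCommGroup M] [AddCommGroup J]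
    [AddCommGroup Z] [Module R M] [Module R J] [Module R Z] (hJ : Module.Injective R J)
    (f : M →ₗ[R] J) (g : J →ₗ[R] Z) (hf : Function.Injective f) (hfg : Function.Exact f g)
    (hg : Function.Surjective g) (hZ : HasFiniteInjectiveDimension R Z) :
    HasFiniteInjectiveDimension R M := by
  obtain ⟨n, I, i1, i2, ι, d, hI, hι, h0, hd, hn⟩ := hZ
  let I' : ℕ → Type u := fun k => Nat.casesOn k J I
  let j1 : ∀ k, AddCommGroup (I' k) := fun k => match k with
    | 0 => (inferInstance : AddCommGroup J)
    | k+1 => i1 k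
  let j2 : ∀ k, @Module R (I' k) _ (j1 k).toAddCommMonoid := fun k => match k with
    | 0 => (inferInstance : Module R J)
    | k+1 => i2 k
  let d' : ∀ k, @LinearMap R R _ _ (RingHom.id R) (I' k) (I' (k+1)) (j1 k).toAddCommMonoid
      (j1 (k+1)).toAddCommMonoid (j2 k) (j2 (k+1)) := fun k => match k with
    | 0 => (ι ∘ₗ g : J →ₗ[R] I 0)
    | k+1 => d k
  refine ⟨n+1, I', j1, j2, f, d', ?_, hf, ?_, ?_, ?_⟩
  · rintro (_|k)
    · exact hJ
    · exact hI k
  · change Function.Exact f (ι ∘ₗ g)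
    rw [LinearMap.coe_comp]
    intro x
    rw [← hfg x]
    simp [map_eq_zero_iff ι hι]
  · rintro (_|k)
    · change Function.Exact (ι ∘ₗ g) (d 0)
      intro x
      rw [h0 x]
      constructor
      · rintro ⟨z, rfl⟩
        obtain ⟨y, rfl⟩ := hg z
        exact ⟨y, rfl⟩
      · rintro ⟨z, rfl⟩
        exact ⟨_, rfl⟩
    · exact hd k
  · rintro (_|k) hk
    · omega
    · exact hn k (by omega)

theorem gor_fid_subsingleton {R : Type u} [CommRing R] {M : Type u} [AddCommGroup M]
    [Module R M] [Subsingleton M] : HasFiniteInjectiveDimension R M := by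
  refine ⟨0, fun _ => PUnit, fun _ => inferInstance, fun _ => inferInstance, 0, fun _ => 0, ?_,
    Function.injective_of_subsingleton _, ?_, ?_, fun _ _ => inferInstance⟩
  · intro j
    exact ⟨fun _ _ _ _ _ _ _ _ _ => ⟨0, fun _ => Subsingleton.elim _ _⟩⟩
  · intro x; simp
  · intro n x; simp

theorem gor_fid_inj {R : Type u} [CommRing R] {M : Type u} [AddCommGroup M]
    [Module R M] (h : Module.Injective R M) : HasFiniteInjectiveDimension R M := by
  refine gor_fid_splice (Z := PUnit) h LinearMap.id 0 Function.injective_id ?_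
    (fun _ => ⟨0, rfl⟩) gor_fid_subsingleton
  intro x; simp


theorem gor_inj_of_ext {R : Type u} [CommRing R] (M : Type u) [AddCommGroup M] [Module R M]
    (h : ∀ (a : Ideal R) (e : Ext (ModuleCat.of R (R ⧸ a)) (ModuleCat.of R M) 1), e = 0) :
    Module.Injective R M := by
  apply Module.Baer.injective
  intro a g
  have hS := LinearMap.shortExact_shortComplexKer (f := a.mkQ) (Submodule.mkQ_surjective a)
  let eq : LinearMap.ker a.mkQ ≃ₗ[R] a := LinearEquiv.ofEq _ _ a.ker_mkQ
  obtain ⟨x, hx⟩ := Ext.contravariant_sequence_exact₁ hS (ModuleCat.of R M)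
    (Ext.mk₀ (ModuleCat.ofHom (g ∘ₗ eq.toLinearMap))) (add_zero 1) (h a _)
  obtain ⟨y, rfl⟩ := (Ext.homEquiv₀ (X := ModuleCat.of R R)).symm.surjective x
  rw [Ext.homEquiv₀_symm_apply, Ext.mk₀_comp_mk₀] at hx
  have h2 := (Ext.mk₀_bijective _ _).1 hx
  refine ⟨y.hom, fun x hx => ?_⟩
  have := congr($h2 (eq.symm ⟨x, hx⟩))
  exact this

theorem gor_exists_inj (R : Type u) [CommRing R] (M : Type u) [AddCommGroup M] [Module R M] :
    ∃ (J : Type u) (_ : AddCommGroup J) (_ : Module R J) (f : M →ₗ[R] J), 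
      Module.Injective R J ∧ Function.Injective f := by
  let J := Injective.under (ModuleCat.of R M)
  refine ⟨J, inferInstance, inferInstance, (Injective.ι (ModuleCat.of R M)).hom, ?_, ?_⟩
  · rw [Module.injective_iff_injective_object]
    exact inferInstanceAs (Injective J)
  · exact (ModuleCat.mono_iff_injective _).1 (Injective.ι_mono (ModuleCat.of R M))

theorem gor_fid_of_ext {R : Type u} [CommRing R] (N : ℕ) : ∀ (M : Type u) [AddCommGroup M]
    [Module R M]
    (_ : ∀ (a : Ideal R) (i : ℕ) (_ : N < i)
      (e : Ext (ModuleCat.of R (R ⧸ a)) (ModuleCat.of R M) i), e = 0),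
    HasFiniteInjectiveDimension R M := by
  induction N with
  | zero =>
    intro M _ _ h
    exact gor_fid_inj (gor_inj_of_ext M fun a e => h a 1 one_pos e)
  | succ N ih =>
    intro M _ _ h
    obtain ⟨J, _, _, f, hJ, hf⟩ := gor_exists_inj R M
    refine gor_fid_splice hJ f (LinearMap.range f).mkQ hf ?_ (Submodule.mkQ_surjective _) (ih _ ?_)
    · exact LinearMap.exact_map_mkQ_range f
    · intro a i hi e
      let S : ShortComplex (ModuleCat.{u} R) := ShortComplex.mk (ModuleCat.ofHom f)
        (ModuleCat.ofHom (LinearMap.range f).mkQ) (by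
          ext x; simp)
      have hS : S.ShortExact := by
        have : Mono S.f := (ModuleCat.mono_iff_injective _).2 hf
        have : Epi S.g := (ModuleCat.epi_iff_surjective _).2 (Submodule.mkQ_surjective _)
        refine ⟨?_⟩
        rw [ShortComplex.ShortExact.moduleCat_exact_iff_function_exact]
        exact LinearMap.exact_map_mkQ_range f
      have : Injective S.X₂ := (Module.injective_iff_injective_object R J).1 hJ
      obtain ⟨y, hy⟩ := Ext.covariant_sequence_exact₃ _ hS (n₀ := i) e rfl (h a (i+1) (by omega) _)
      rw [← hy]
      obtain ⟨k, rfl⟩ : ∃ k, i = k + 1 := ⟨i - 1, by omega⟩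
      rw [Ext.eq_zero_of_injective y]
      simp

end gorext

theorem gor_inj_restrict {A R E : Type u} [CommRing A] [CommRing R] [Algebra A R] [Module.Flat A R]
    [AddCommGroup E] [Module A E] [Module R E] [IsScalarTower A R E] (hE : Module.Injective R E) :
    Module.Injective A E := by
  refine ⟨fun X Y _ _ _ _ f hf g => ?_⟩
  have h1 : Function.Injective (f.baseChange R) :=
    Module.Flat.lTensor_preserves_injective_linearMap (M := R) f hf
  obtain ⟨h, hh⟩ := hE.out (f.baseChange R) h1 (g.liftBaseChange R)
  refine ⟨(h.restrictScalars A) ∘ₗ (TensorProduct.mk A R Y 1), fun x => ?_⟩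
  have := hh (1 ⊗ₜ x)
  simpa using this

theorem gor_hull (R : Type u) [CommRing R] [IsLocalRing R] :
    ∃ (E : Type u) (_ : AddCommGroup E) (_ : Module R E)
      (f : (R ⧸ IsLocalRing.maximalIdeal R) →ₗ[R] E),
      Module.Injective R E ∧ Function.Injective f ∧
      ∀ e : E, (∀ x ∈ IsLocalRing.maximalIdeal R, x • e = 0) → e ∈ LinearMap.range f := by
  obtain ⟨J, _, _, f, hJ, hf⟩ := gor_exists_inj R (R ⧸ IsLocalRing.maximalIdeal R)
  set K := LinearMap.range f with hK
  let 𝒮 : Set (Submodule R J) := {E | K ≤ E ∧ ∀ e ∈ E, e ≠ 0 → ∃ r : R, r • e ∈ K ∧ r • e ≠ 0}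
  obtain ⟨E, hKE, hE⟩ : ∃ E, K ≤ E ∧ Maximal (· ∈ 𝒮) E := by
    apply zorn_le_nonempty₀
    · intro c hc hchain y hy
      refine ⟨sSup c, ⟨?_, ?_⟩, fun z hz => le_sSup hz⟩
      · exact (hc hy).1.trans (le_sSup hy)
      · intro e he
        obtain ⟨z, hz, hez⟩ := (Submodule.mem_sSup_of_directed ⟨y, hy⟩ hchain.directedOn).1 he
        exact (hc hz).2 e hez
    · exact ⟨le_rfl, fun e he h => ⟨1, by simpa, by simpa⟩⟩
  obtain ⟨C, -, hC⟩ : ∃ C, ⊥ ≤ C ∧ Maximal (· ∈ {C : Submodule R J | Disjoint E C}) C := by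
    apply zorn_le_nonempty₀
    · intro c hc hchain y hy
      refine ⟨sSup c, ?_, fun z hz => le_sSup hz⟩
      exact hchain.directedOn.disjoint_sSup_right.2 fun z hz => hc hz
    · exact disjoint_bot_right
  have hdis : Disjoint E C := hC.1
  let q : E →ₗ[R] (J ⧸ C) := C.mkQ ∘ₗ E.subtype
  have hq : Function.Injective q := by
    rw [← LinearMap.ker_eq_bot, LinearMap.ker_eq_bot']
    intro e he
    have : (e : J) ∈ C := by simpa [q] using he
    exact Subtype.ext (Submodule.disjoint_def.1 hdis _ e.2 this)
  obtain ⟨g, hg⟩ := hJ.out q hq E.subtype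
  have hg' : ∀ e (_ : e ∈ E), g (C.mkQ e) = e := fun e he => hg ⟨e, he⟩
  have hrange : LinearMap.range g ∈ 𝒮 := by
    refine ⟨fun y hy => ⟨C.mkQ y, hg' _ (hKE hy)⟩, ?_⟩
    rintro _ ⟨t, rfl⟩ hne
    obtain ⟨t, rfl⟩ := C.mkQ_surjective t
    have ht : t ∉ C := by
      intro ht
      apply hne
      have : C.mkQ t = 0 := by simpa using ht
      rw [this, map_zero]
    have hnd : ¬ Disjoint E (C ⊔ Submodule.span R {t}) := by
      intro h
      have := hC.2 h le_sup_left
      exact ht (this (Submodule.mem_sup_right (Submodule.mem_span_singleton_self t)))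
    rw [Submodule.disjoint_def] at hnd
    push Not at hnd
    obtain ⟨e, heE, he, he0⟩ := hnd
    obtain ⟨c, hc, z, hz, rfl⟩ := Submodule.mem_sup.1 he
    obtain ⟨r, rfl⟩ := Submodule.mem_span_singleton.1 hz
    have h1 : g (C.mkQ (c + r • t)) = r • g (C.mkQ t) := by
      have : C.mkQ c = 0 := by simpa using hc
      rw [map_add, this, zero_add, map_smul, map_smul]
    obtain ⟨s, hs, hs0⟩ := hE.1.2 _ heE he0
    rw [hg' _ heE] at h1
    rw [h1] at hs hs0
    exact ⟨s * r, by rwa [mul_smul], by rwa [mul_smul]⟩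
  have hle : E ≤ LinearMap.range g := fun e he => ⟨_, hg' e he⟩
  have hle' : LinearMap.range g ≤ E := hE.2 hrange hle
  let ρ : J →ₗ[R] E := (g ∘ₗ C.mkQ).codRestrict E fun y => hle' ⟨_, rfl⟩
  have hρ : ∀ e : E, ρ e = e := fun e => Subtype.ext (hg' e e.2)
  refine ⟨E, inferInstance, inferInstance, f.codRestrict E fun y => hKE ⟨y, rfl⟩, ?_, ?_, ?_⟩
  · refine ⟨fun X Y _ _ _ _ i hi t => ?_⟩
    obtain ⟨h, hh⟩ := hJ.out i hi (E.subtype ∘ₗ t)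
    refine ⟨ρ ∘ₗ h, fun x => ?_⟩
    simp only [LinearMap.coe_comp, Function.comp_apply, hh]
    exact hρ _
  · intro x y hxy
    exact hf (congrArg Subtype.val hxy)
  · intro e he
    by_cases h0 : e = 0
    · rw [h0]; exact zero_mem _
    obtain ⟨r, hr, hr0⟩ := hE.1.2 e e.2 (by simpa using h0)
    have hu : IsUnit r := by
      by_contra hu
      exact hr0 (congrArg Subtype.val (he r ((IsLocalRing.mem_maximalIdeal _).2 hu)))
    obtain ⟨u, rfl⟩ := hu
    have : (e : J) ∈ K := by
      have := K.smul_mem (↑u⁻¹ : R) hr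
      rwa [smul_smul, Units.inv_mul, one_smul] at this
    obtain ⟨z, hz⟩ := this
    exact ⟨z, Subtype.ext hz⟩

open TensorProduct

section gorfg
variable {R : Type u} [CommRing R] {Q Y Z : Type*} [AddCommGroup Q] [AddCommGroup Y]
  [AddCommGroup Z] [Module R Q] [Module R Y] [Module R Z]

def GorFG (φ : Q →ₗ[R] Y) : Prop := ∃ N : Submodule R Y, N.FG ∧ ∀ q, φ q ∈ N

theorem GorFG.add {φ ψ : Q →ₗ[R] Y} (h1 : GorFG φ) (h2 : GorFG ψ) : GorFG (φ + ψ) := by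
  obtain ⟨N, hN, h⟩ := h1
  obtain ⟨N', hN', h'⟩ := h2
  exact ⟨N ⊔ N', hN.sup hN', fun q => Submodule.add_mem_sup (h q) (h' q)⟩

theorem GorFG.neg {φ : Q →ₗ[R] Y} (h1 : GorFG φ) : GorFG (-φ) := by
  obtain ⟨N, hN, h⟩ := h1
  exact ⟨N, hN, fun q => N.neg_mem (h q)⟩

theorem GorFG.sub {φ ψ : Q →ₗ[R] Y} (h1 : GorFG φ) (h2 : GorFG ψ) : GorFG (φ - ψ) := by
  rw [sub_eq_add_neg]; exact h1.add h2.neg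

theorem GorFG.left {φ : Q →ₗ[R] Y} (h1 : GorFG φ) (α : Y →ₗ[R] Z) : GorFG (α ∘ₗ φ) := by
  obtain ⟨N, hN, h⟩ := h1
  exact ⟨N.map α, hN.map α, fun q => ⟨_, h q, rfl⟩⟩

theorem GorFG.right {φ : Q →ₗ[R] Y} (h1 : GorFG φ) (α : Z →ₗ[R] Q) : GorFG (φ ∘ₗ α) := by
  obtain ⟨N, hN, h⟩ := h1
  exact ⟨N, hN, fun q => h _⟩

theorem gor_fg_lift [IsNoetherianRing R] (N : Submodule R Y) (hN : N.FG) (β : Z →ₗ[R] Y) :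
    ∃ N' : Submodule R Z, N'.FG ∧ N'.map β = N ⊓ LinearMap.range β := by
  have h1 : (N ⊓ LinearMap.range β).FG := by
    have := isNoetherian_of_fg_of_noetherian N hN
    exact Submodule.FG.of_le hN inf_le_left
  obtain ⟨T, hT⟩ := h1
  have h2 : (T : Set Y) ⊆ β '' Set.univ := by
    intro t ht
    have : t ∈ N ⊓ LinearMap.range β := hT ▸ Submodule.subset_span ht
    simpa using this.2
  classical
  obtain ⟨T', -, rfl⟩ := Finset.subset_set_image_iff.1 h2
  exact ⟨Submodule.span R T', ⟨T', rfl⟩, by rw [Submodule.map_span, ← hT]; simp⟩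

theorem gor_proj_lift [Module.Projective R Q] (φ : Q →ₗ[R] Y) (N : Submodule R Y) (hN : N.FG)
    (α : Z →ₗ[R] Y) (h : ∀ q, φ q ∈ N ⊔ LinearMap.range α) :
    ∃ c : Q →ₗ[R] Z, GorFG (φ - α ∘ₗ c) := by
  let κ : (N × Z) →ₗ[R] Y := N.subtype.coprod α
  have hκ : LinearMap.range κ = N ⊔ LinearMap.range α := by simp [κ, LinearMap.range_coprod]
  obtain ⟨s, hs⟩ := Module.projective_lifting_property κ.rangeRestrict
    (φ.codRestrict (LinearMap.range κ) (fun q => hκ ▸ h q)) κ.surjective_rangeRestrict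
  refine ⟨LinearMap.snd _ _ _ ∘ₗ s, N, hN, fun q => ?_⟩
  have : κ (s q) = φ q := congrArg Subtype.val congr($hs q)
  have h2 : φ q = (s q).1 + α (s q).2 := by rw [← this]; simp [κ]
  simp [h2]

def GorV (d : Q →ₗ[R] Q) (Y : Type*) [AddCommGroup Y] [Module R Y] : Prop :=
  ∀ f : Q →ₗ[R] Y, GorFG (f ∘ₗ d) → ∃ g : Q →ₗ[R] Y, GorFG (f - g ∘ₗ d)

theorem gor_v_fin (d : Q →ₗ[R] Q) [Module.Finite R Y] : GorV d Y :=
  fun _ _ => ⟨0, ⊤, Module.Finite.fg_top, fun _ => trivial⟩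

theorem gor_v_equiv (d : Q →ₗ[R] Q) (e : Y ≃ₗ[R] Z) (h : GorV d Y) : GorV d Z := by
  intro f hf
  obtain ⟨g, hg⟩ := h (e.symm.toLinearMap ∘ₗ f) (by
    rw [LinearMap.comp_assoc]; exact hf.left _)
  refine ⟨e.toLinearMap ∘ₗ g, ?_⟩
  have := hg.left e.toLinearMap
  convert this using 1
  ext q; simp

theorem gor_v_step [IsNoetherianRing R] [Module.Projective R Q] (d h : Q →ₗ[R] Q)
    (hdd : d ∘ₗ d = 0)
    (x : R) (hx : ∀ q, d (h q) + h (d q) = x • q) {Y' Y'' : Type*} [AddCommGroup Y']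
    [Module R Y'] [AddCommGroup Y''] [Module R Y''] (α : Y' →ₗ[R] Y) (β : Y →ₗ[R] Y'')
    (hα : Function.Injective α) (hα' : ∀ y, x • y = 0 → y ∈ LinearMap.range α)
    (hβ : Function.Surjective β) (hβ1 : ∀ y, β (x • y) = 0)
    (hβ2 : ∀ y, β y = 0 → ∃ z, y = x • z)
    (h1 : GorV d Y') (h2 : GorV d Y'') : GorV d Y := by
  intro f hf
  have hdd' : ∀ q, d (d q) = 0 := fun q => congr($hdd q)
  set g := f ∘ₗ h with hg
  have e1 : GorFG (x • f - g ∘ₗ d) := by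
    convert hf.right h using 1
    ext q
    simp only [LinearMap.sub_apply, LinearMap.smul_apply, LinearMap.comp_apply, hg]
    rw [← map_smul, ← hx, map_add, add_sub_cancel_right]
  have e2 : GorFG ((β ∘ₗ g) ∘ₗ d) := by
    convert (e1.left β).neg using 1
    ext q
    simp only [LinearMap.sub_apply, LinearMap.smul_apply, LinearMap.comp_apply, LinearMap.neg_apply,
      map_sub, hβ1, zero_sub, neg_neg]
  obtain ⟨ebar, he⟩ := h2 _ e2
  obtain ⟨e, rfl⟩ := Module.projective_lifting_property β ebar hβ
  obtain ⟨N'', hN'', hmem⟩ := he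
  obtain ⟨N1, hN1, hN1'⟩ := gor_fg_lift N'' hN'' β
  obtain ⟨g', hg'⟩ := gor_proj_lift (g - e ∘ₗ d) N1 hN1 (x • LinearMap.id) (fun q => by
    have : β ((g - e ∘ₗ d) q) ∈ N1.map β := by
      rw [hN1']; refine ⟨?_, ⟨_, rfl⟩⟩
      simpa using hmem q
    obtain ⟨n, hn, hn'⟩ := this
    obtain ⟨z, hz⟩ := hβ2 ((g - e ∘ₗ d) q - n) (by rw [map_sub, hn', sub_self])
    rw [← add_sub_cancel n ((g - e ∘ₗ d) q), hz]
    exact Submodule.add_mem_sup hn ⟨z, rfl⟩)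
  set φ := f - g' ∘ₗ d with hφ
  have e3 : GorFG (x • φ) := by
    convert e1.add (hg'.right d) using 1
    ext q
    simp [hφ, hdd', smul_sub]
  obtain ⟨N, hN, hNx⟩ := e3
  obtain ⟨N2, hN2, hN2'⟩ := gor_fg_lift N hN (x • LinearMap.id : Y →ₗ[R] Y)
  obtain ⟨f'', hf''⟩ := gor_proj_lift φ N2 hN2 α (fun q => by
    have : x • φ q ∈ N2.map (x • LinearMap.id : Y →ₗ[R] Y) := by
      rw [hN2']; exact ⟨hNx q, ⟨φ q, rfl⟩⟩
    obtain ⟨n, hn, hn'⟩ := this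
    have h3 := hα' (φ q - n) (by
      rw [smul_sub, ← hn']; simp)
    rw [← add_sub_cancel n (φ q)]
    exact Submodule.add_mem_sup hn h3)
  have e4 : GorFG (α ∘ₗ (f'' ∘ₗ d)) := by
    convert hf.sub (hf''.right d) using 1
    ext q
    simp [hφ, hdd']
  have e5 : GorFG (f'' ∘ₗ d) := by
    obtain ⟨N3, hN3, h3⟩ := e4
    obtain ⟨N4, hN4, hN4'⟩ := gor_fg_lift N3 hN3 α
    refine ⟨N4, hN4, fun q => ?_⟩
    have : α (f'' (d q)) ∈ N4.map α := by rw [hN4']; exact ⟨h3 q, ⟨_, rfl⟩⟩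
    obtain ⟨n, hn, hn'⟩ := this
    rw [← hα hn'.symm] at hn
    exact hn
  obtain ⟨g'', hg''⟩ := h1 _ e5
  refine ⟨g' + α ∘ₗ g'', ?_⟩
  convert hf''.add (hg''.left α) using 1
  ext q
  simp [hφ]
  abel

end gorfg

section gorhom
variable {R : Type u} [CommRing R] [IsNoetherianRing R] [IsLocalRing R] {E : Type u}
  [AddCommGroup E] [Module R E]

theorem gor_hom_fin (f : (R ⧸ IsLocalRing.maximalIdeal R) →ₗ[R] E)
    (hsoc : ∀ e : E, (∀ x ∈ IsLocalRing.maximalIdeal R, x • e = 0) → e ∈ LinearMap.range f)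
    {M : Type u} [AddCommGroup M] [Module R M] (hM : Module.Finite R M) :
    (∀ x ∈ IsLocalRing.maximalIdeal R, ∀ y : M, x • y = 0) → IsNoetherian R (M →ₗ[R] E) := by
  induction hM using IsNoetherianRing.induction_on_isQuotientEquivQuotientPrime with
  | subsingleton N =>
    intro _
    have : Subsingleton (N →ₗ[R] E) :=
      ⟨fun a b => LinearMap.ext fun y => by rw [Subsingleton.elim y 0]; simp⟩
    infer_instance
  | quotient N p t =>
    intro h
    let ev : (N →ₗ[R] E) →ₗ[R] E := LinearMap.applyₗ (t.symm 1)
    let ev' := ev.codRestrict (LinearMap.range f) (fun φ => hsoc _ fun x hx => by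
      change x • φ _ = 0
      rw [← map_smul, h x hx, map_zero])
    refine isNoetherian_of_injective ev' ?_
    intro a b hab
    have hab' : a (t.symm 1) = b (t.symm 1) := congrArg Subtype.val hab
    ext y
    obtain ⟨y, rfl⟩ := t.symm.surjective y
    obtain ⟨r, rfl⟩ := Ideal.Quotient.mk_surjective y
    have : Ideal.Quotient.mk p.1 r = r • 1 := by simp [Algebra.smul_def]
    rw [this, map_smul, map_smul, map_smul, hab']
  | exact N₁ N₂ N₃ i g hi hg hig h₁ h₃ =>
    intro h
    have := h₁ fun x hx y => hi (by simp [h x hx])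
    have := h₃ fun x hx y => by
      obtain ⟨y, rfl⟩ := hg y
      simp [← map_smul, h x hx]
    refine isNoetherian_of_range_eq_ker (LinearMap.lcomp R E g) (LinearMap.lcomp R E i) ?_
    ext φ
    constructor
    · rintro ⟨ψ, rfl⟩
      ext y
      simp [hig.apply_apply_eq_zero]
    · intro hφ
      have hk : LinearMap.ker g ≤ LinearMap.ker φ := by
        intro y hy
        obtain ⟨z, rfl⟩ := (hig y).1 hy
        exact congr($hφ z)
      let eqv := g.quotKerEquivOfSurjective hg
      refine ⟨(LinearMap.ker g).liftQ φ hk ∘ₗ eqv.symm.toLinearMap, ?_⟩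
      ext y
      have : eqv.symm (g y) = Submodule.Quotient.mk y := by
        rw [LinearEquiv.symm_apply_eq]; rfl
      simp [this]

theorem gor_v_all (hE : Module.Injective R E) (f : (R ⧸ IsLocalRing.maximalIdeal R) →ₗ[R] E)
    (hsoc : ∀ e : E, (∀ x ∈ IsLocalRing.maximalIdeal R, x • e = 0) → e ∈ LinearMap.range f)
    {Q : Type*} [AddCommGroup Q] [Module R Q] [Module.Projective R Q] (d : Q →ₗ[R] Q)
    (hdd : d ∘ₗ d = 0)
    (hh : ∀ x ∈ IsLocalRing.maximalIdeal R, ∃ h : Q →ₗ[R] Q, ∀ q, d (h q) + h (d q) = x • q)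
    (b : Ideal R) :
    ∀ (M : Type u) [AddCommGroup M] [Module R M] [Module.Finite R M],
      (∀ x ∈ b, ∀ y : M, x • y = 0) → GorV d (M →ₗ[R] E) := by
  induction b using IsNoetherian.induction with
  | hgt b ih =>
  intro M _ _ _ hb
  by_cases hm : IsLocalRing.maximalIdeal R ≤ b
  · have := gor_hom_fin f hsoc (M := M) inferInstance fun x hx => hb x (hm hx)
    exact gor_v_fin d
  obtain ⟨x, hxm, hxb⟩ := Set.not_subset.1 hm
  have hlt : b < b ⊔ Ideal.span {x} := by
    rw [left_lt_sup]
    rw [Ideal.span_singleton_le_iff_mem]; exact hxb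
  let f : M →ₗ[R] M := LinearMap.lsmul R M x
  have hkill : ∀ (L : Type u) [AddCommGroup L] [Module R L], (∀ y ∈ b, ∀ z : L, y • z = 0) →
    (∀ z : L, x • z = 0) → ∀ y ∈ b ⊔ Ideal.span {x}, ∀ z : L, y • z = 0 := by
    intro L _ _ h1 h2 y hy z
    obtain ⟨u, hu, v, hv, rfl⟩ := Submodule.mem_sup.1 hy
    obtain ⟨w, rfl⟩ := Ideal.mem_span_singleton'.1 hv
    rw [add_smul, h1 u hu, mul_smul, h2]; simp
  have hK : GorV d (LinearMap.ker f →ₗ[R] E) := by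
    refine ih _ hlt _ (hkill _ (fun y hy z => Subtype.ext (hb y hy z)) fun z => Subtype.ext z.2)
  have hQ : GorV d ((M ⧸ LinearMap.range f) →ₗ[R] E) := by
    refine ih _ hlt _ (hkill _ (fun y hy z => ?_) fun z => ?_)
    · obtain ⟨z, rfl⟩ := Submodule.mkQ_surjective _ z
      rw [← map_smul, hb y hy, map_zero]
    · obtain ⟨z, rfl⟩ := Submodule.mkQ_surjective _ z
      rw [← map_smul, Submodule.mkQ_apply, Submodule.Quotient.mk_eq_zero]
      exact ⟨z, rfl⟩
  obtain ⟨h, hh⟩ := hh x hxm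
  refine gor_v_step d h hdd x hh (LinearMap.lcomp R E (LinearMap.range f).mkQ)
    (LinearMap.lcomp R E (LinearMap.ker f).subtype) ?_ ?_ ?_ ?_ ?_ hQ hK
  · intro a b hab
    apply Submodule.linearMap_qext
    exact hab
  · intro φ hφ
    refine ⟨(LinearMap.range f).liftQ φ ?_, ?_⟩
    · rintro _ ⟨y, rfl⟩
      have := congr($hφ y)
      simpa [f] using this
    · ext y; simp
  · intro φ
    obtain ⟨ψ, hψ⟩ := hE.out (LinearMap.ker f).subtype (Submodule.subtype_injective _) φ
    exact ⟨ψ, LinearMap.ext hψ⟩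
  · intro φ
    ext ⟨y, hy⟩
    have hy' : x • y = 0 := hy
    change (x • φ) y = 0
    rw [LinearMap.smul_apply, ← map_smul, hy', map_zero]
  · intro φ hφ
    have hk : LinearMap.ker f ≤ LinearMap.ker φ := fun y hy => congr($hφ ⟨y, hy⟩)
    obtain ⟨ψ, hψ⟩ := hE.out (LinearMap.range f).subtype (Submodule.subtype_injective _)
      ((LinearMap.ker f).liftQ φ hk ∘ₗ f.quotKerEquivRange.symm.toLinearMap)
    refine ⟨ψ, ?_⟩
    ext y
    have h1 := hψ ⟨f y, ⟨y, rfl⟩⟩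
    have : f.quotKerEquivRange.symm ⟨f y, ⟨y, rfl⟩⟩ = Submodule.Quotient.mk y := by
      rw [LinearEquiv.symm_apply_eq]; rfl
    simp only [Submodule.coe_subtype, LinearMap.comp_apply, LinearEquiv.coe_coe, this] at h1
    rw [LinearMap.smul_apply, ← map_smul]
    exact h1.symm

theorem gor_v_E (hE : Module.Injective R E) (f : (R ⧸ IsLocalRing.maximalIdeal R) →ₗ[R] E)
    (hsoc : ∀ e : E, (∀ x ∈ IsLocalRing.maximalIdeal R, x • e = 0) → e ∈ LinearMap.range f)
    {Q : Type*} [AddCommGroup Q] [Module R Q] [Module.Projective R Q] (d : Q →ₗ[R] Q)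
    (hdd : d ∘ₗ d = 0)
    (hh : ∀ x ∈ IsLocalRing.maximalIdeal R, ∃ h : Q →ₗ[R] Q, ∀ q, d (h q) + h (d q) = x • q) :
    GorV d E :=
  gor_v_equiv d (LinearMap.ringLmapEquivSelf R R E)
    (gor_v_all hE f hsoc d hdd hh ⊥ R (fun x hx y => by simp [(Submodule.mem_bot R).1 hx]))

end gorhom

section gorD
variable {R : Type u} [CommRing R] {S : Type} {Y : Type*} [AddCommGroup Y] [Module R Y]

theorem gor_rel [IsNoetherianRing R] {l : ℕ} (e : Fin l → Y) :
    ∃ (k : ℕ) (G : Fin k → Fin l → R), (∀ j, ∑ i, G j i • e i = 0) ∧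
      ∀ c : Fin l → R, ∑ i, c i • e i = 0 → ∃ y : Fin k → R, ∀ i, c i = ∑ j, y j * G j i := by
  obtain ⟨k, G, hG⟩ := Submodule.fg_iff_exists_fin_generating_family.1
    (IsNoetherian.noetherian (LinearMap.ker (Fintype.linearCombination R e)))
  refine ⟨k, G, fun j => ?_, fun c hc => ?_⟩
  · have : G j ∈ LinearMap.ker (Fintype.linearCombination R e) :=
      hG ▸ Submodule.subset_span ⟨j, rfl⟩
    simpa [Fintype.linearCombination_apply] using this
  · have : c ∈ LinearMap.ker (Fintype.linearCombination R e) := by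
      simpa [Fintype.linearCombination_apply] using hc
    rw [← hG, Submodule.mem_span_range_iff_exists_fun] at this
    obtain ⟨y, rfl⟩ := this
    exact ⟨y, fun i => by simp⟩

variable (R S Y) in
def gorFs : Submodule R (S → Y) where
  carrier := {f | {s | f s ≠ 0}.Finite}
  add_mem' {f g} hf hg := (hf.union hg).subset fun s hs => by
    by_contra h
    simp only [Set.mem_union, Set.mem_ofPred_eq, not_or, not_not] at h
    exact hs (by simp [h.1, h.2])
  zero_mem' := by simp
  smul_mem' c f hf := hf.subset fun s hs h => hs (by simp [h])

theorem mem_gorFs {f : S → Y} : f ∈ gorFs R S Y ↔ {s | f s ≠ 0}.Finite := Iff.rfl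

noncomputable def gorD (d : (S →₀ R) →ₗ[R] (S →₀ R)) (Y : Type*) [AddCommGroup Y] [Module R Y] :
    (S → Y) →ₗ[R] (S → Y) where
  toFun f s := Finsupp.linearCombination R f (d (Finsupp.single s 1))
  map_add' f g := by
    ext s
    simp [Finsupp.linearCombination_apply, Finsupp.sum, Finset.sum_add_distrib]
  map_smul' c f := by
    ext s
    simp [Finsupp.linearCombination_apply, Finsupp.sum, Finset.smul_sum, smul_comm c]

theorem gorD_apply (d : (S →₀ R) →ₗ[R] (S →₀ R)) (f : S → Y) (s : S) :
    gorD d Y f s = Finsupp.linearCombination R f (d (Finsupp.single s 1)) := rfl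

theorem gorD_lin (d : (S →₀ R) →ₗ[R] (S →₀ R)) (f : S → Y) :
    Finsupp.linearCombination R (gorD d Y f) = Finsupp.linearCombination R f ∘ₗ d := by
  ext s
  simp [gorD_apply]

theorem gorD_gorD (d : (S →₀ R) →ₗ[R] (S →₀ R)) (hdd : d ∘ₗ d = 0) (f : S → Y) :
    gorD d Y (gorD d Y f) = 0 := by
  ext s
  rw [gorD_apply, gorD_lin]
  have : d (d (Finsupp.single s 1)) = 0 := congr($hdd _)
  simp [this]

theorem gorD_fs (d : (S →₀ R) →ₗ[R] (S →₀ R))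
    (ha : ∀ t, {s | d (Finsupp.single s 1) t ≠ 0}.Finite) :
    gorFs R S Y ≤ (gorFs R S Y).comap (gorD d Y) := by
  intro f hf
  change {s | gorD d Y f s ≠ 0}.Finite
  refine (Set.Finite.biUnion hf (fun t _ => ha t)).subset fun s hs => ?_
  by_contra h
  simp only [Set.mem_iUnion, not_exists, Set.mem_ofPred_eq, not_not] at h
  apply hs
  rw [gorD_apply, Finsupp.linearCombination_apply, Finsupp.sum]
  refine Finset.sum_eq_zero fun t _ => ?_
  by_cases h0 : f t = 0
  · simp [h0]
  · simp [h t h0]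

theorem gor_X_flat [IsNoetherianRing R] : Module.Flat R ((S → R) ⧸ gorFs R S R) := by
  apply Module.Flat.of_forall_isTrivialRelation
  intro l f x hfx
  have : ∀ i, ∃ r, (gorFs R S R).mkQ r = x i := fun i => Submodule.mkQ_surjective _ (x i)
  choose r hr using this
  have h1 : ∑ i, f i • r i ∈ gorFs R S R := by
    rw [← Submodule.Quotient.mk_eq_zero, ← Submodule.mkQ_apply]
    simpa [hr] using hfx
  obtain ⟨k, G, hG, hG'⟩ := gor_rel (R := R) f
  have h2 : ∀ s, ∃ y : Fin k → R, ((∑ i, f i • r i) s = 0 → ∀ i, r i s = ∑ j, y j * G j i) := by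
    intro s
    by_cases hs : (∑ i, f i • r i) s = 0
    · obtain ⟨y, hy⟩ := hG' (fun i => r i s) (by simpa [mul_comm] using hs)
      exact ⟨y, fun _ => hy⟩
    · exact ⟨0, fun h => absurd h hs⟩
  choose y hy using h2
  refine ⟨k, fun i j => G j i, fun j => (gorFs R S R).mkQ (fun s => y s j), fun i => ?_, fun j => ?_⟩
  · rw [← hr]
    simp only [← map_smul, ← map_sum]
    rw [← sub_eq_zero, ← map_sub, Submodule.mkQ_apply, Submodule.Quotient.mk_eq_zero]
    refine h1.subset fun s hs h => hs ?_
    simp [hy s h, mul_comm]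
  · simpa [mul_comm] using hG j

theorem gor_core [IsNoetherianRing R] (d : (S →₀ R) →ₗ[R] (S →₀ R)) (hdd : d ∘ₗ d = 0)
    (ha : ∀ t, {s | d (Finsupp.single s 1) t ≠ 0}.Finite) (hV : GorV d Y)
    (hX : Function.Exact (LinearMap.rTensor Y ((gorFs R S R).mapQ _ (gorD d R) (gorD_fs d ha)))
      (LinearMap.rTensor Y ((gorFs R S R).mapQ _ (gorD d R) (gorD_fs d ha))))
    (f : S → Y) (hf : gorD d Y f = 0) : ∃ v, f - gorD d Y v ∈ gorFs R S Y := by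
  obtain ⟨g, N, hN, hg⟩ := hV (Finsupp.linearCombination R f) (by
    rw [← gorD_lin, hf]
    exact ⟨⊥, Submodule.fg_bot, fun q => by simp⟩)
  let v : S → Y := fun s => g (Finsupp.single s 1)
  have hgv : g = Finsupp.linearCombination R v := by ext s; simp [v]
  set f' := f - gorD d Y v with hf'
  have hf'N : ∀ s, f' s ∈ N := by
    intro s
    have := hg (Finsupp.single s 1)
    rw [hgv] at this
    simpa [hf', gorD_apply] using this
  have hDf' : gorD d Y f' = 0 := by rw [hf', map_sub, hf, gorD_gorD d hdd, sub_zero]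
  obtain ⟨l, e, he⟩ := Submodule.fg_iff_exists_fin_generating_family.1 hN
  have : ∀ s, ∃ r : Fin l → R, ∑ k, r k • e k = f' s := by
    intro s
    rw [← Submodule.mem_span_range_iff_exists_fun, he]
    exact hf'N s
  choose r hr using this
  set q := (gorFs R S R).mkQ with hq
  set Dbar := (gorFs R S R).mapQ _ (gorD d R) (gorD_fs d ha) with hDbar
  let ρ : Fin l → S → R := fun k s => r s k
  let ζ : ((S → R) ⧸ gorFs R S R) ⊗[R] Y := ∑ k, q (ρ k) ⊗ₜ e k
  have hζ : LinearMap.rTensor Y Dbar ζ = 0 := by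
    obtain ⟨n, G, hG, hG'⟩ := gor_rel (R := R) e
    have h1 : ∀ s, ∃ y : Fin n → R, ∀ k, gorD d R (ρ k) s = ∑ j, y j * G j k := by
      intro s
      apply hG'
      have := congrFun hDf' s
      rw [gorD_apply, Finsupp.linearCombination_apply, Finsupp.sum] at this
      simp only [gorD_apply, Finsupp.linearCombination_apply, Finsupp.sum, Finset.sum_smul]
      rw [Finset.sum_comm]
      simpa [← hr, Finset.smul_sum, smul_smul, ρ] using this
    choose y hy using h1
    have h2 : ∀ k, gorD d R (ρ k) = ∑ j, G j k • (fun s => y s j) := by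
      intro k
      ext s
      rw [hy]
      simp [mul_comm]
    calc LinearMap.rTensor Y Dbar ζ = ∑ k, q (gorD d R (ρ k)) ⊗ₜ e k := by
          simp [ζ, hDbar, hq]
      _ = ∑ k, ∑ j, q (fun s => y s j) ⊗ₜ (G j k • e k) := by
          refine Finset.sum_congr rfl fun k _ => ?_
          rw [h2, map_sum, TensorProduct.sum_tmul]
          simp only [map_smul, TensorProduct.smul_tmul]
      _ = ∑ j, q (fun s => y s j) ⊗ₜ (∑ k, G j k • e k) := by
          rw [Finset.sum_comm]
          simp only [TensorProduct.tmul_sum]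
      _ = 0 := by simp [hG]
  obtain ⟨η, hη⟩ := (hX ζ).1 hζ
  let μ0 : (S → R) →ₗ[R] Y →ₗ[R] ((S → Y) ⧸ gorFs R S Y) :=
    LinearMap.mk₂ R (fun r e => (gorFs R S Y).mkQ (fun s => r s • e))
      (fun a b c => by rw [← map_add]; congr 1; ext s; simp [add_smul])
      (fun a b c => by rw [← map_smul]; congr 1; ext s; simp [mul_smul])
      (fun a b c => by rw [← map_add]; congr 1; ext s; simp)
      (fun a b c => by rw [← map_smul]; congr 1; ext s; simp [smul_comm a])
  let μ1 : ((S → R) ⧸ gorFs R S R) →ₗ[R] Y →ₗ[R] ((S → Y) ⧸ gorFs R S Y) :=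
    (gorFs R S R).liftQ μ0 (by
      intro c hc
      ext z
      change (gorFs R S Y).mkQ (fun s => c s • z) = 0
      rw [Submodule.mkQ_apply, Submodule.Quotient.mk_eq_zero]
      exact Set.Finite.subset hc fun s hs h => hs (by simp [h]))
  let μ := TensorProduct.lift μ1
  have hμ : ∀ (c : S → R) (z : Y), μ (q c ⊗ₜ z) = (gorFs R S Y).mkQ (fun s => c s • z) :=
    fun c z => rfl
  set DY := (gorFs R S Y).mapQ _ (gorD d Y) (gorD_fs d ha) with hDY
  have hcomm : ∀ t, μ (LinearMap.rTensor Y Dbar t) = DY (μ t) := by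
    intro t
    induction t with
    | zero => simp
    | add a b ha hb => simp [ha, hb]
    | tmul c z =>
      obtain ⟨c, rfl⟩ := Submodule.mkQ_surjective _ c
      have : Dbar (q c) = q (gorD d R c) := by simp [hDbar, hq]
      rw [LinearMap.rTensor_tmul, ← hq, this, hμ, hμ, hDY, Submodule.mkQ_apply, Submodule.mkQ_apply,
        Submodule.mapQ_apply]
      congr 1
      ext s
      simp [gorD_apply, Finsupp.linearCombination_apply, Finsupp.sum, Finset.sum_smul, mul_smul]
  have hfin : μ ζ = (gorFs R S Y).mkQ f' := by
    simp only [ζ, map_sum, hμ]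
    rw [← map_sum]
    congr 1
    ext s
    simp [← hr, ρ]
  rw [← hη, hcomm] at hfin
  obtain ⟨w, hw⟩ := Submodule.mkQ_surjective _ (μ η)
  rw [← hw, hDY, Submodule.mkQ_apply, Submodule.mapQ_apply, ← Submodule.mkQ_apply, eq_comm,
    ← sub_eq_zero, ← map_sub, Submodule.mkQ_apply, Submodule.Quotient.mk_eq_zero, hf', sub_sub,
    ← map_add] at hfin
  exact ⟨_, hfin⟩

end gorD

section gorcore2
variable {A R E : Type u} [CommRing A] [CommRing R] [Algebra A R] [Module.Flat A R]
    [AddCommGroup E] [Module R E] [IsNoetherianRing R] [IsLocalRing R] {S : Type}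

theorem gor_core2 (M : Submonoid A) [IsLocalization M R]
    (H : ∀ (X : ℤ → Type u) (_ : ∀ n, AddCommGroup (X n)) (_ : ∀ n, Module A (X n))
        (d : ∀ n, X n →ₗ[A] X (n + 1)),
        (∀ n, Module.Flat A (X n)) →
        (∀ n, Function.Exact (d n) (d (n + 1))) →
        ∀ (I : Type u) [AddCommGroup I] [Module A I], Module.Injective A I →
    ∀ n, Function.Exact (LinearMap.rTensor I (d n)) (LinearMap.rTensor I (d (n + 1))))
    (hE : Module.Injective R E) (ι : (R ⧸ IsLocalRing.maximalIdeal R) →ₗ[R] E)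
    (hsoc : ∀ e : E, (∀ x ∈ IsLocalRing.maximalIdeal R, x • e = 0) → e ∈ LinearMap.range ι)
    (d : (S →₀ R) →ₗ[R] (S →₀ R)) (hdd : d ∘ₗ d = 0)
    (ha : ∀ t, {s | d (Finsupp.single s 1) t ≠ 0}.Finite)
    (hb : ∀ r : S → R, gorD d R r ∈ gorFs R S R → ∃ w, r - gorD d R w ∈ gorFs R S R)
    (hh : ∀ x ∈ IsLocalRing.maximalIdeal R, ∃ h : (S →₀ R) →ₗ[R] (S →₀ R),
      ∀ q, d (h q) + h (d q) = x • q)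
    (f : S → E) (hf : gorD d E f = 0) : ∃ v, f - gorD d E v ∈ gorFs R S E := by
  let _ : Module A E := Module.compHom E (algebraMap A R)
  haveI : IsScalarTower A R E := ⟨fun a r e => by
    rw [Algebra.smul_def, mul_smul]; rfl⟩
  refine gor_core d hdd ha (gor_v_E hE ι hsoc d hdd hh) ?_ f hf
  set Dbar := (gorFs R S R).mapQ _ (gorD d R) (gorD_fs d ha) with hDbar
  have hex : Function.Exact Dbar Dbar := by
    intro c
    obtain ⟨c, rfl⟩ := Submodule.mkQ_surjective _ c
    simp only [hDbar, Submodule.mkQ_apply, Submodule.mapQ_apply, Submodule.Quotient.mk_eq_zero]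
    constructor
    · intro h
      obtain ⟨w, hw⟩ := hb c h
      refine ⟨(gorFs R S R).mkQ w, ?_⟩
      rw [Submodule.mkQ_apply, Submodule.mapQ_apply, eq_comm, Submodule.Quotient.eq]
      exact hw
    · rintro ⟨w, hw⟩
      obtain ⟨w, rfl⟩ := Submodule.mkQ_surjective _ w
      rw [Submodule.mkQ_apply, Submodule.mapQ_apply, Submodule.Quotient.eq] at hw
      have := gorD_fs d ha hw
      rw [Submodule.mem_comap, map_sub, gorD_gorD d hdd, zero_sub] at this
      simpa using this
  have hflat : Module.Flat A ((S → R) ⧸ gorFs R S R) :=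
    haveI := gor_X_flat (R := R) (S := S)
    Module.Flat.trans A R _
  have key := H (fun _ => (S → R) ⧸ gorFs R S R) (fun _ => inferInstance) (fun _ => inferInstance)
    (fun _ => Dbar.restrictScalars A) (fun _ => hflat) (fun _ => hex) E (gor_inj_restrict hE) 0
  haveI := IsLocalization.tensorProduct_compatibleSMul M R ((S → R) ⧸ gorFs R S R) E
  let eqv := TensorProduct.equivOfCompatibleSMul A R R ((S → R) ⧸ gorFs R S R) E
  have hcomm : ∀ t, eqv (LinearMap.rTensor E Dbar t)
      = LinearMap.rTensor E (Dbar.restrictScalars A) (eqv t) := by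
    intro t
    induction t with
    | zero => simp
    | add a b ha hb => simp [ha, hb]
    | tmul c z => rfl
  intro t
  rw [← eqv.map_eq_zero_iff, hcomm, key (eqv t)]
  constructor
  · rintro ⟨w, hw⟩
    obtain ⟨w, rfl⟩ := eqv.surjective w
    rw [← hcomm] at hw
    exact ⟨w, eqv.injective hw⟩
  · rintro ⟨w, rfl⟩
    exact ⟨eqv w, (hcomm w).symm⟩
end gorcore2

theorem gor_cogen {R : Type u} [CommRing R] [IsLocalRing R] {E : Type u} [AddCommGroup E]
    [Module R E] (hE : Module.Injective R E) (ι : (R ⧸ IsLocalRing.maximalIdeal R) →ₗ[R] E)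
    (hι : Function.Injective ι) {Q : Type u} [AddCommGroup Q] [Module R Q] (q : Q) (hq : q ≠ 0) :
    ∃ θ : Q →ₗ[R] E, θ q ≠ 0 := by
  let t := LinearMap.toSpanSingleton R Q q
  have hk : LinearMap.ker t ≤ IsLocalRing.maximalIdeal R := by
    apply IsLocalRing.le_maximalIdeal
    intro h
    have : (1 : R) ∈ LinearMap.ker t := h ▸ trivial
    exact hq (by simpa [t] using this)
  obtain ⟨θ, hθ⟩ := hE.out ((LinearMap.ker t).liftQ t le_rfl)
    (LinearMap.ker_eq_bot.1 (Submodule.ker_liftQ_eq_bot _ _ _ le_rfl))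
    ((LinearMap.ker t).liftQ (ι ∘ₗ (IsLocalRing.maximalIdeal R).mkQ) (by
      intro x hx
      have : (IsLocalRing.maximalIdeal R).mkQ x = 0 := by
        rw [Submodule.mkQ_apply, Submodule.Quotient.mk_eq_zero]; exact hk hx
      rw [LinearMap.mem_ker, LinearMap.comp_apply, this, map_zero]))
  refine ⟨θ, fun h => ?_⟩
  have h1 := hθ (Submodule.Quotient.mk 1)
  simp only [Submodule.liftQ_apply, t, LinearMap.toSpanSingleton_apply, one_smul, h,
    LinearMap.comp_apply] at h1
  have h2 := (map_eq_zero_iff ι hι).1 h1.symm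
  rw [Submodule.mkQ_apply, Submodule.Quotient.mk_eq_zero] at h2
  exact (Ideal.ne_top_iff_one _).1 (IsLocalRing.maximalIdeal.isMaximal R).ne_top h2

section gormat
variable {R : Type u} [CommRing R] {a : ℕ → ℕ}

theorem gor_fs_iff {Y : Type*} [AddCommGroup Y] [Module R Y] (f : (Σ n, Fin (a n)) → Y) :
    f ∈ gorFs R (Σ n, Fin (a n)) Y ↔ ∃ N, ∀ n, N ≤ n → ∀ i, f ⟨n, i⟩ = 0 := by
  rw [mem_gorFs]
  constructor
  · intro h
    obtain ⟨N, hN⟩ := (h.image Sigma.fst).bddAbove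
    refine ⟨N+1, fun n hn i => ?_⟩
    by_contra hne
    have := hN ⟨⟨n, i⟩, hne, rfl⟩
    simp only at this
    omega
  · rintro ⟨N, hN⟩
    refine (Set.Finite.biUnion (Set.finite_lt_nat N)
      (fun n _ => Set.finite_range (fun i : Fin (a n) => (⟨n, i⟩ : Σ n, Fin (a n))))).subset ?_
    rintro ⟨n, i⟩ h
    have : n < N := by
      by_contra hn
      exact h (hN n (by omega) i)
    exact Set.mem_biUnion this ⟨i, rfl⟩

noncomputable def gorUp (M : ∀ n, (Fin (a (n+1)) → R) →ₗ[R] (Fin (a n) → R)) :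
    ((Σ n, Fin (a n)) →₀ R) →ₗ[R] ((Σ n, Fin (a n)) →₀ R) :=
  Finsupp.linearCombination R (fun s => ∑ i' : Fin (a (s.1+1)),
    Finsupp.single ⟨s.1+1, i'⟩ (M s.1 (Pi.single i' 1) s.2))

noncomputable def gorDown (H : ∀ n, (Fin (a n) → R) →ₗ[R] (Fin (a (n+1)) → R)) :
    ((Σ n, Fin (a n)) →₀ R) →ₗ[R] ((Σ n, Fin (a n)) →₀ R) :=
  Finsupp.linearCombination R (fun s => match s with
    | ⟨0, _⟩ => 0
    | ⟨n+1, i⟩ => ∑ i' : Fin (a n), Finsupp.single ⟨n, i'⟩ (H n (Pi.single i' 1) i))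

theorem gorUp_D (M : ∀ n, (Fin (a (n+1)) → R) →ₗ[R] (Fin (a n) → R)) {Y : Type*} [AddCommGroup Y]
    [Module R Y] (f : (Σ n, Fin (a n)) → Y) (n : ℕ) (i : Fin (a n)) :
    gorD (gorUp M) Y f ⟨n, i⟩ = ∑ i', M n (Pi.single i' 1) i • f ⟨n+1, i'⟩ := by
  simp [gorD_apply, gorUp]

theorem gor_pi_sum {m : ℕ} {Z : Type*} [AddCommGroup Z] [Module R Z] (L : (Fin m → R) →ₗ[R] Z)
    (y : Fin m → R) : L y = ∑ i, y i • L (Pi.single i 1) := by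
  rw [LinearMap.pi_apply_eq_sum_univ L y]
  refine Finset.sum_congr rfl fun i _ => ?_
  congr 2
  ext j
  simp [Pi.single_apply, eq_comm]

theorem gor_lin_pi {m n : ℕ} (L : (Fin m → R) →ₗ[R] (Fin n → R)) (y : Fin m → R) (i : Fin n) :
    L y i = ∑ i', L (Pi.single i' 1) i * y i' := by
  rw [gor_pi_sum L y]
  simp [mul_comm]

theorem gorUp_D' (M : ∀ n, (Fin (a (n+1)) → R) →ₗ[R] (Fin (a n) → R))
    (f : (Σ n, Fin (a n)) → R) (n : ℕ) (i : Fin (a n)) :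
    gorD (gorUp M) R f ⟨n, i⟩ = M n (fun i' => f ⟨n+1, i'⟩) i := by
  rw [gorUp_D, gor_lin_pi]; simp

theorem gorDown_zero (H : ∀ n, (Fin (a n) → R) →ₗ[R] (Fin (a (n+1)) → R))
    (f : (Σ n, Fin (a n)) → R) (i : Fin (a 0)) :
    gorD (gorDown H) R f ⟨0, i⟩ = 0 := by
  simp [gorD_apply, gorDown]

theorem gorDown_succ (H : ∀ n, (Fin (a n) → R) →ₗ[R] (Fin (a (n+1)) → R))
    (f : (Σ n, Fin (a n)) → R) (n : ℕ) (i : Fin (a (n+1))) :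
    gorD (gorDown H) R f ⟨n+1, i⟩ = H n (fun i' => f ⟨n, i'⟩) i := by
  rw [gor_lin_pi]
  simp [gorD_apply, gorDown]

theorem gor_test {S : Type} (p q : S →₀ R)
    (h : ∀ r : S → R, Finsupp.linearCombination R r p = Finsupp.linearCombination R r q) :
    p = q := by
  classical
  ext t
  have := h (Pi.single t 1)
  have e : ∀ p : S →₀ R, Finsupp.linearCombination R (Pi.single t (1 : R)) p = p t := by
    intro p
    rw [Finsupp.linearCombination_apply, Finsupp.sum]
    simp only [Pi.single_apply, smul_eq_mul, mul_ite, mul_one, mul_zero]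
    simp
    exact fun h => h.symm
  rwa [e, e] at this

theorem gorUp_sq (M : ∀ n, (Fin (a (n+1)) → R) →ₗ[R] (Fin (a n) → R))
    (hM : ∀ n, M n ∘ₗ M (n+1) = 0) : gorUp M ∘ₗ gorUp M = 0 := by
  ext1 s
  ext1
  apply gor_test
  intro r
  have h1 : gorD (gorUp M) R (gorD (gorUp M) R r) s
    = Finsupp.linearCombination R r (gorUp M (gorUp M (Finsupp.single s 1))) := by
    rw [gorD_apply, gorD_lin]; rfl
  simp only [LinearMap.comp_apply, Finsupp.lsingle_apply, LinearMap.zero_apply, map_zero, ← h1]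
  obtain ⟨n, i⟩ := s
  rw [gorUp_D']
  have : (fun i' => gorD (gorUp M) R r ⟨n+1, i'⟩) = M (n+1) (fun i' => r ⟨n+1+1, i'⟩) := by
    ext i'; rw [gorUp_D']
  rw [this]
  exact congr($(hM n) _ i)

theorem gorUp_fin (M : ∀ n, (Fin (a (n+1)) → R) →ₗ[R] (Fin (a n) → R)) (t : Σ n, Fin (a n)) :
    {s | gorUp M (Finsupp.single s 1) t ≠ 0}.Finite := by
  refine (Set.finite_range (fun i : Fin (a (t.1-1)) => (⟨t.1-1, i⟩ : Σ n, Fin (a n)))).subset ?_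
  rintro ⟨n, i⟩ h
  have : t.1 = n + 1 := by
    by_contra hne
    apply h
    simp only [gorUp, Finsupp.linearCombination_single, one_smul, Finsupp.coe_finsetSum,
      Finset.sum_apply]
    refine Finset.sum_eq_zero fun i' _ => ?_
    rw [Finsupp.single_apply, if_neg]
    rintro rfl
    exact hne rfl
  obtain rfl : n = t.1 - 1 := by omega
  exact ⟨i, rfl⟩

theorem gor_homotopy (M : ∀ n, (Fin (a (n+1)) → R) →ₗ[R] (Fin (a n) → R))
    (hM : ∀ n, Function.Exact (M (n+1)) (M n)) (x : R)
    (hx : ∀ y, x • y ∈ LinearMap.range (M 0)) :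
    ∃ h : ((Σ n, Fin (a n)) →₀ R) →ₗ[R] ((Σ n, Fin (a n)) →₀ R),
      ∀ q, gorUp M (h q) + h (gorUp M q) = x • q := by
  have lift : ∀ {m n k : ℕ} (L : (Fin m → R) →ₗ[R] (Fin n → R)) (T : (Fin k → R) →ₗ[R] (Fin n → R)),
      (∀ y, T y ∈ LinearMap.range L) → ∃ T' : (Fin k → R) →ₗ[R] (Fin m → R), ∀ y, L (T' y) = T y := by
    intro m n k L T hT
    obtain ⟨s, hs⟩ := Module.projective_lifting_property L.rangeRestrict
      (T.codRestrict (LinearMap.range L) hT) L.surjective_rangeRestrict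
    exact ⟨s, fun y => congrArg Subtype.val congr($hs y)⟩
  let Inv : ∀ n, ((Fin (a n) → R) →ₗ[R] (Fin (a (n+1)) → R)) → Prop := fun n H =>
    ∀ y, M n (H (M n y)) = x • M n y
  obtain ⟨H0, hH0⟩ := lift (M 0) (x • LinearMap.id) hx
  have hH0' : Inv 0 H0 := fun y => by rw [hH0]; rfl
  have step : ∀ n (H : {H // Inv n H}), ∃ H' : {H // Inv (n+1) H},
      ∀ y, M (n+1) (H'.1 y) = x • y - H.1 (M n y) := by
    rintro n ⟨H, hH⟩
    obtain ⟨H', hH'⟩ := lift (M (n+1)) (x • LinearMap.id - H ∘ₗ M n) (fun y => by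
      apply (hM n _).1
      simp [hH y])
    refine ⟨⟨H', fun y => ?_⟩, hH'⟩
    rw [hH']
    simp [(hM n).apply_apply_eq_zero]
  choose st hst using step
  let HH : ∀ n, {H // Inv n H} := fun n => Nat.rec ⟨H0, hH0'⟩ (fun n H => st n H) n
  let H : ∀ n, (Fin (a n) → R) →ₗ[R] (Fin (a (n+1)) → R) := fun n => (HH n).1
  have hs : ∀ n y, M (n+1) (H (n+1) y) = x • y - H n (M n y) := fun n y => hst n (HH n) y
  have h0 : ∀ y, M 0 (H 0 y) = x • y := hH0
  refine ⟨gorDown H, fun q => gor_test _ _ fun r => ?_⟩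
  have key : gorD (gorDown H) R (gorD (gorUp M) R r) + gorD (gorUp M) R (gorD (gorDown H) R r)
      = x • r := by
    ext ⟨n, i⟩
    have e1 : ∀ n, (fun i' => gorD (gorUp M) R r ⟨n, i'⟩) = M n (fun i' => r ⟨n+1, i'⟩) := by
      intro n; ext i'; rw [gorUp_D']
    have e2 : ∀ n, (fun i' => gorD (gorDown H) R r ⟨n+1, i'⟩) = H n (fun i' => r ⟨n, i'⟩) := by
      intro n; ext i'; rw [gorDown_succ]
    rw [Pi.add_apply, gorUp_D', e2]
    cases n with
    | zero =>
      rw [gorDown_zero, h0, zero_add]; simp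
    | succ n =>
      rw [gorDown_succ, e1, hs]
      simp
  have k2 := congrArg (fun t => Finsupp.linearCombination R t q) key
  have hadd : ∀ u v : (Σ n, Fin (a n)) → R, Finsupp.linearCombination R (u + v) q
      = Finsupp.linearCombination R u q + Finsupp.linearCombination R v q := by
    intro u v
    simp [Finsupp.linearCombination_apply, Finsupp.sum, mul_add, Finset.sum_add_distrib]
  have hsm : Finsupp.linearCombination R (x • r) q = x • Finsupp.linearCombination R r q := by
    simp [Finsupp.linearCombination_apply, Finsupp.sum, Finset.mul_sum, mul_left_comm]
  simp only [hadd, hsm, gorD_lin, LinearMap.comp_apply] at k2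
  rw [map_add, map_smul, ← k2, add_comm]

theorem gor_b (M : ∀ n, (Fin (a (n+1)) → R) →ₗ[R] (Fin (a n) → R))
    (hM : ∀ n, Function.Exact (M (n+1)) (M n)) (r : (Σ n, Fin (a n)) → R)
    (hr : gorD (gorUp M) R r ∈ gorFs R _ R) :
    ∃ w, r - gorD (gorUp M) R w ∈ gorFs R _ R := by
  obtain ⟨N, hN⟩ := (gor_fs_iff _).1 hr
  have : ∀ n, ∃ w : Fin (a (n+1+1)) → R, N ≤ n → (fun i => r ⟨n+1, i⟩) = M (n+1) w := by
    intro n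
    by_cases hn : N ≤ n
    · have : M n (fun i => r ⟨n+1, i⟩) = 0 := by
        ext i
        have := hN n hn i
        rwa [gorUp_D'] at this
      obtain ⟨w, hw⟩ := (hM n _).1 this
      exact ⟨w, fun _ => hw.symm⟩
    · exact ⟨0, fun h => absurd h hn⟩
  choose w hw using this
  let W : (Σ n, Fin (a n)) → R := fun s => match s with
    | ⟨0, _⟩ => 0
    | ⟨1, _⟩ => 0
    | ⟨n+2, i⟩ => w n i
  refine ⟨W, (gor_fs_iff _).2 ⟨N+1, fun n hn i => ?_⟩⟩
  obtain ⟨n, rfl⟩ : ∃ m, n = m + 1 := ⟨n - 1, by omega⟩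
  rw [Pi.sub_apply, gorUp_D', sub_eq_zero]
  exact congrFun (hw n (by omega)) i

theorem gor_E_exact (M : ∀ n, (Fin (a (n+1)) → R) →ₗ[R] (Fin (a n) → R)) {E : Type u}
    [AddCommGroup E] [Module R E]
    (hc : ∀ f : (Σ n, Fin (a n)) → E, gorD (gorUp M) E f = 0 → ∃ v,
      f - gorD (gorUp M) E v ∈ gorFs R _ E) :
    ∃ N, ∀ n, N ≤ n → ∀ y : Fin (a (n+1)) → E, (∀ i, ∑ i', M n (Pi.single i' 1) i • y i' = 0) →
      ∃ z : Fin (a (n+1+1)) → E, ∀ i, y i = ∑ i', M (n+1) (Pi.single i' 1) i • z i' := by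
  by_contra! hcon
  have : ∀ n, ∃ y : Fin (a (n+1)) → E, (∀ i, ∑ i', M n (Pi.single i' 1) i • y i' = 0) ∧
      ((∃ z : Fin (a (n+1+1)) → E, ∀ i, y i = ∑ i', M (n+1) (Pi.single i' 1) i • z i') →
        ∀ y : Fin (a (n+1)) → E, (∀ i, ∑ i', M n (Pi.single i' 1) i • y i' = 0) →
      ∃ z : Fin (a (n+1+1)) → E, ∀ i, y i = ∑ i', M (n+1) (Pi.single i' 1) i • z i') := by
    intro n
    by_cases h : ∀ y : Fin (a (n+1)) → E, (∀ i, ∑ i', M n (Pi.single i' 1) i • y i' = 0) →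
      ∃ z : Fin (a (n+1+1)) → E, ∀ i, y i = ∑ i', M (n+1) (Pi.single i' 1) i • z i'
    · exact ⟨0, by simp, fun _ => h⟩
    · push Not at h
      obtain ⟨y, hy, hy'⟩ := h
      refine ⟨y, hy, fun ⟨z, hz⟩ => ?_⟩
      obtain ⟨i, hi⟩ := hy' z
      exact absurd (hz i) hi
  choose y hy1 hy2 using this
  let f : (Σ n, Fin (a n)) → E := fun s => match s with
    | ⟨0, _⟩ => 0
    | ⟨n+1, i⟩ => y n i
  obtain ⟨v, hv⟩ := hc f (by
    ext ⟨n, i⟩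
    rw [gorUp_D]
    exact hy1 n i)
  obtain ⟨N, hN⟩ := (gor_fs_iff _).1 hv
  obtain ⟨n, hn, y', hy', hz⟩ := hcon N
  obtain ⟨z, hz'⟩ := hy2 n ⟨fun i => v ⟨n+1+1, i⟩, fun i => by
    have := hN (n+1) (by omega) i
    rw [Pi.sub_apply, gorUp_D, sub_eq_zero] at this
    exact this⟩ y' hy'
  obtain ⟨i, hi⟩ := hz z
  exact hi (hz' i)

theorem gor_dual_exact [IsLocalRing R] {E : Type u} [AddCommGroup E]
    [Module R E] (hE : Module.Injective R E) (ι : (R ⧸ IsLocalRing.maximalIdeal R) →ₗ[R] E)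
    (hι : Function.Injective ι) {l m n : ℕ} (P : (Fin m → R) →ₗ[R] (Fin l → R))
    (P' : (Fin n → R) →ₗ[R] (Fin m → R))
    (h : ∀ y : Fin m → E, (∀ i, ∑ i', P (Pi.single i' 1) i • y i' = 0) →
      ∃ z : Fin n → E, ∀ i, y i = ∑ i', P' (Pi.single i' 1) i • z i')
    (φ : (Fin m → R) →ₗ[R] R) (hφ : φ ∘ₗ P' = 0) : ∃ ψ : (Fin l → R) →ₗ[R] R, φ = ψ ∘ₗ P := by
  by_contra! hcon
  let B := LinearMap.range (LinearMap.lcomp R R P)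
  have hq : B.mkQ φ ≠ 0 := by
    rw [Submodule.mkQ_apply, Ne, Submodule.Quotient.mk_eq_zero]
    rintro ⟨ψ, hψ⟩
    exact hcon ψ hψ.symm
  obtain ⟨θ, hθ⟩ := gor_cogen hE ι hι _ hq
  let Θ := θ ∘ₗ B.mkQ
  have hexp : ∀ χ : (Fin m → R) →ₗ[R] R, Θ χ
      = ∑ i, χ (Pi.single i 1) • Θ (LinearMap.proj i) := by
    intro χ
    have : χ = ∑ i, χ (Pi.single i 1) • (LinearMap.proj i : (Fin m → R) →ₗ[R] R) := by
      ext i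
      simp [Pi.single_apply]
    conv_lhs => rw [this]
    simp
  obtain ⟨z, hz⟩ := h (fun i => Θ (LinearMap.proj i)) (by
    intro i
    have h1 := hexp (LinearMap.proj i ∘ₗ P)
    have h2 : Θ (LinearMap.proj i ∘ₗ P) = 0 := by
      have : B.mkQ (LinearMap.proj i ∘ₗ P) = 0 := by
        rw [Submodule.mkQ_apply, Submodule.Quotient.mk_eq_zero]
        exact ⟨LinearMap.proj i, rfl⟩
      simp only [Θ, LinearMap.comp_apply, this, map_zero]
    rw [h2] at h1
    exact h1.symm)
  apply hθ
  change Θ φ = 0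
  rw [hexp]
  simp only [hz, Finset.smul_sum, smul_smul]
  rw [Finset.sum_comm]
  refine Finset.sum_eq_zero fun i' _ => ?_
  rw [← Finset.sum_smul]
  have : ∑ i, φ (Pi.single i 1) * P' (Pi.single i' 1) i = φ (P' (Pi.single i' 1)) := by
    rw [gor_pi_sum φ (P' (Pi.single i' 1))]
    simp [mul_comm]
  rw [this]
  have : φ (P' (Pi.single i' 1)) = 0 := congr($hφ _)
  rw [this, zero_smul]

end gormat

theorem gor_backward (A : Type u) [CommRing A] [IsNoetherianRing A]
    (H : ∀ (X : ℤ → Type u) (_ : ∀ n, AddCommGroup (X n)) (_ : ∀ n, Module A (X n))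
        (d : ∀ n, X n →ₗ[A] X (n + 1)),
        (∀ n, Module.Flat A (X n)) →
        (∀ n, Function.Exact (d n) (d (n + 1))) →
        ∀ (I : Type u) [AddCommGroup I] [Module A I], Module.Injective A I →
    ∀ n, Function.Exact (LinearMap.rTensor I (d n)) (LinearMap.rTensor I (d (n + 1)))) :
    IsGorensteinRing A := by
  intro p hp
  have : IsNoetherianRing (Localization.AtPrime p) :=
    IsLocalization.isNoetherianRing p.primeCompl _ inferInstance
  have : Module.Flat A (Localization.AtPrime p) := IsLocalization.flat _ p.primeCompl
  let R := Localization.AtPrime p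
  obtain ⟨E, _, _, ι, hE, hι, hsoc⟩ := gor_hull R
  obtain ⟨a, Ω, _, _, π, j, hπ, hj, hjπ, ⟨eqv⟩⟩ :=
    gor_exists_res (R := R) (R ⧸ IsLocalRing.maximalIdeal R)
  let M : ∀ n, (Fin (a (n+1)) → R) →ₗ[R] (Fin (a n) → R) := fun n => j n ∘ₗ π (n+1)
  have hM : ∀ n, Function.Exact (M (n+1)) (M n) := by
    intro n y
    constructor
    · intro h
      have h1 : π (n+1) y = 0 := hj n (by rw [map_zero]; exact h)
      obtain ⟨z, rfl⟩ := (hjπ (n+1) y).1 h1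
      obtain ⟨z, rfl⟩ := hπ _ z
      exact ⟨z, rfl⟩
    · rintro ⟨z, rfl⟩
      change j n (π (n+1) (j (n+1) (π (n+2) z))) = 0
      rw [(hjπ (n+1)).apply_apply_eq_zero, map_zero]
  have hx : ∀ x ∈ IsLocalRing.maximalIdeal R, ∀ y, x • y ∈ LinearMap.range (M 0) := by
    intro x hx y
    have h1 : π 0 (x • y) = 0 := by
      apply eqv.injective
      rw [map_smul, map_smul, map_zero]
      obtain ⟨r, hr⟩ := Ideal.Quotient.mk_surjective (eqv (π 0 y))
      rw [← hr]
      change Ideal.Quotient.mk _ (x * r) = 0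
      rw [Ideal.Quotient.eq_zero_iff_mem]
      exact Ideal.mul_mem_right _ _ hx
    obtain ⟨z, hz⟩ := (hjπ 0 _).1 h1
    obtain ⟨z, rfl⟩ := hπ _ z
    exact ⟨z, hz⟩
  obtain ⟨N, hN⟩ := gor_E_exact M (E := E) (fun f hf =>
    gor_core2 p.primeCompl H hE ι hsoc (gorUp M)
      (gorUp_sq M fun n => by
        apply LinearMap.ext
        intro y
        exact (hM n).apply_apply_eq_zero y)
      (gorUp_fin M) (gor_b M hM) (fun x h => gor_homotopy M hM x (hx x h)) f hf)
  have h1 : GorExtV (R := R) R (N+1) (Ω 0) :=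
    gor_extv_res a Ω π j hπ hj hjπ N fun n hn φ hφ =>
      gor_dual_exact hE ι hι (M n) (M (n+1)) (hN n hn) φ hφ
  have h2 := gor_extv_equiv eqv h1
  refine gor_fid_of_ext (N+1) R fun I i hi e => ?_
  exact gor_extv_all h2 ⊥ (R ⧸ I) (fun x hx y => by simp [(Submodule.mem_bot R).1 hx]) i hi.le e

/-- A commutative noetherian ring is Gorenstein iff every acyclic complex of flat modules is
N-totally acyclic. -/
theorem gorenstein_iff_acyclic_flat_nTotallyAcyclic
    (A : Type u) [CommRing A] [IsNoetherianRing A] :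
    IsGorensteinRing A ↔
      ∀ (X : ℤ → Type u) (_ : ∀ n, AddCommGroup (X n)) (_ : ∀ n, Module A (X n))
        (d : ∀ n, X n →ₗ[A] X (n + 1)),
        (∀ n, Module.Flat A (X n)) →
        (∀ n, Function.Exact (d n) (d (n + 1))) →
        IsNTotallyAcyclic A X d := by
  constructor
  · intro hG X _ _ d hflat hd
    exact ⟨hd, fun I _ _ hI => gor_forward d hG hd I⟩
  · intro H
    exact gor_backward A fun X i1 i2 d hflat hd => (H X i1 i2 d hflat hd).2
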